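/- For all integers g, ℓ ≥ 1 and every n ≥ 1, the pair (g exc_ℓ, g den_{g+ℓ}) is equidistributed with (rdes, rmaj) over S_n where r = g + ℓ − 1; that is, for all integers a, b, the number of σ ∈ S_n with g exc_ℓ(σ) = a and g den_{g+ℓ}(σ) = b equals the number of σ ∈ S_n with rdes(σ) = a and rmaj(σ) = b. (Theorem 1.2(2), Huang–Yan: (g exc_ℓ, g den_{g+ℓ}) is (g+ℓ−1)-Euler–Mahonian.) -/

import Mathlib

open Finset

namespace PaperStmt

/-- 1-based position of `i : Fin n` (so positions run through `1,…,n`). -/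
def pos1 {n : ℕ} (i : Fin n) : ℕ := (i : ℕ) + 1

/-- 1-based value `σ_i` of the permutation `σ` at position `i`. -/
def val1 {n : ℕ} (σ : Equiv.Perm (Fin n)) (i : Fin n) : ℕ := (σ i : ℕ) + 1

/-- The number of inversions of the subsequence of `σ` consisting of the letters at the
positions satisfying `P`: pairs of positions `i < j`, both satisfying `P`,
with `σ_i > σ_j`. -/
def invOn {n : ℕ} (σ : Equiv.Perm (Fin n)) (P : Fin n → Prop) [DecidablePred P] : ℕ :=
  (univ.filter fun p : Fin n × Fin n =>
    p.1 < p.2 ∧ P p.1 ∧ P p.2 ∧ val1 σ p.2 < val1 σ p.1).card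

/-- `inv σ`: the number of inversions of `σ`. -/
def inv {n : ℕ} (σ : Equiv.Perm (Fin n)) : ℕ := invOn σ (fun _ => True)

/-- `Exc(σ)`: the set of excedances, i.e. positions `i` with `σ_i > i`. -/
def excSet {n : ℕ} (σ : Equiv.Perm (Fin n)) : Finset (Fin n) :=
  univ.filter fun i => pos1 i < val1 σ i

/-- `exc σ`: the number of excedances. -/
def exc {n : ℕ} (σ : Equiv.Perm (Fin n)) : ℕ := (excSet σ).card

/-- `exc_r(σ)`: the number of `r`-level excedances, i.e. positions `i ≥ r` with `σ_i > i`. -/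
def excLvl {n : ℕ} (r : ℕ) (σ : Equiv.Perm (Fin n)) : ℕ :=
  (univ.filter fun i => pos1 i < val1 σ i ∧ r ≤ pos1 i).card

/-- Denert's statistic `den σ`. -/
def den {n : ℕ} (σ : Equiv.Perm (Fin n)) : ℕ :=
  ((univ.filter fun i => pos1 i < val1 σ i).sum pos1)
  + invOn σ (fun i => pos1 i < val1 σ i)
  + invOn σ (fun i => ¬ pos1 i < val1 σ i)

/-- The `h`-level Denert statistic `den_h(σ)`. -/
def denLvl {n : ℕ} (h : ℕ) (σ : Equiv.Perm (Fin n)) : ℕ :=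
  ((univ.filter fun i => pos1 i < val1 σ i ∧ h ≤ val1 σ i).sum pos1)
  + invOn σ (fun i => pos1 i < val1 σ i ∧ h ≤ val1 σ i)
  + invOn σ (fun i => ¬ (pos1 i < val1 σ i ∧ h ≤ val1 σ i))

/-- `g exc_ℓ(σ)`: the number of `g`-gap `ℓ`-level excedances,
i.e. positions `i ≥ ℓ` with `σ_i ≥ i + g`. -/
def gexc {n : ℕ} (g l : ℕ) (σ : Equiv.Perm (Fin n)) : ℕ :=
  (univ.filter fun i => pos1 i + g ≤ val1 σ i ∧ l ≤ pos1 i).card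

/-- `gExclp_h(σ)`: the set of `g`-gap `h`-level excedance-letter positions,
i.e. positions `i` with `σ_i ≥ i + g` and `σ_i ≥ h`. -/
def gExclpSet {n : ℕ} (g h : ℕ) (σ : Equiv.Perm (Fin n)) : Finset (Fin n) :=
  univ.filter fun i => pos1 i + g ≤ val1 σ i ∧ h ≤ val1 σ i

/-- The `g`-gap `h`-level Denert statistic `g den_h(σ)`. -/
def gden {n : ℕ} (g h : ℕ) (σ : Equiv.Perm (Fin n)) : ℕ :=
  ((univ.filter fun i => pos1 i + g ≤ val1 σ i ∧ h ≤ val1 σ i).sum fun i => pos1 i + g - 1)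
  + invOn σ (fun i => pos1 i + g ≤ val1 σ i ∧ h ≤ val1 σ i)
  + invOn σ (fun i => ¬ (pos1 i + g ≤ val1 σ i ∧ h ≤ val1 σ i))

/-- `rexc σ`: the number of `r`-excedances, i.e. positions `i` with `σ_i ≥ i + r`. -/
def rexc {n : ℕ} (r : ℕ) (σ : Equiv.Perm (Fin n)) : ℕ :=
  (univ.filter fun i => pos1 i + r ≤ val1 σ i).card

/-- The `r`-Denert statistic `rden σ`. -/
def rden {n : ℕ} (r : ℕ) (σ : Equiv.Perm (Fin n)) : ℕ :=
  ((univ.filter fun i => pos1 i + r ≤ val1 σ i).sum fun i => pos1 i + r - 1)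
  + invOn σ (fun i => pos1 i + r ≤ val1 σ i)
  + invOn σ (fun i => ¬ pos1 i + r ≤ val1 σ i)

/-- Pairs `(i, i+1)` of adjacent positions forming an `r`-descent: `σ_i ≥ σ_{i+1} + r`. -/
def rdesPairs {n : ℕ} (r : ℕ) (σ : Equiv.Perm (Fin n)) : Finset (Fin n × Fin n) :=
  univ.filter fun p => pos1 p.2 = pos1 p.1 + 1 ∧ val1 σ p.2 + r ≤ val1 σ p.1

/-- `rdes σ`: the number of `r`-descents. -/
def rdes {n : ℕ} (r : ℕ) (σ : Equiv.Perm (Fin n)) : ℕ := (rdesPairs r σ).card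

/-- `rmaj σ`: the sum of the `r`-descents plus the number of pairs `i < j`
with `σ_j < σ_i < σ_j + r`. -/
def rmaj {n : ℕ} (r : ℕ) (σ : Equiv.Perm (Fin n)) : ℕ :=
  ((rdesPairs r σ).sum fun p => pos1 p.1)
  + (univ.filter fun p : Fin n × Fin n =>
      p.1 < p.2 ∧ val1 σ p.2 < val1 σ p.1 ∧ val1 σ p.1 < val1 σ p.2 + r).card

/-- `des σ`: the number of descents, i.e. positions `i ∈ [n-1]` with `σ_i > σ_{i+1}`. -/
def des {n : ℕ} (σ : Equiv.Perm (Fin n)) : ℕ :=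
  (univ.filter fun p : Fin n × Fin n =>
    pos1 p.2 = pos1 p.1 + 1 ∧ val1 σ p.2 < val1 σ p.1).card

/-- `maj σ`: the major index, i.e. the sum of the descents of `σ`. -/
def maj {n : ℕ} (σ : Equiv.Perm (Fin n)) : ℕ :=
  ((univ.filter fun p : Fin n × Fin n =>
    pos1 p.2 = pos1 p.1 + 1 ∧ val1 σ p.2 < val1 σ p.1).sum fun p => pos1 p.1)

/-- The permutation of `ℕ` sending each element of `S` to the next larger element of `S` and the
maximum of `S` to its minimum, fixing everything outside `S`. -/
def rot (S : Finset ℕ) : Equiv.Perm ℕ :=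
  (finRotate S.card).extendDomain (p := fun x => x ∈ S) (S.orderIsoOfFin rfl).toEquiv

theorem rot_of_notMem {S : Finset ℕ} {x : ℕ} (h : x ∉ S) : rot S x = x :=
  Equiv.Perm.extendDomain_apply_not_subtype _ _ h

theorem rot_orderIsoOfFin (S : Finset ℕ) (i : Fin S.card) :
    rot S (S.orderIsoOfFin rfl i) = S.orderIsoOfFin rfl (finRotate _ i) :=
  Equiv.Perm.extendDomain_apply_image _ _ _

theorem exists_orderIsoOfFin {S : Finset ℕ} {x : ℕ} (h : x ∈ S) :
    ∃ i, (S.orderIsoOfFin rfl i : ℕ) = x :=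
  ⟨(S.orderIsoOfFin rfl).symm ⟨x, h⟩, by simp⟩

theorem rot_mem {S : Finset ℕ} {x : ℕ} (h : x ∈ S) : rot S x ∈ S := by
  obtain ⟨i, rfl⟩ := exists_orderIsoOfFin h
  rw [rot_orderIsoOfFin]
  exact Subtype.prop _

theorem rot_max {S : Finset ℕ} {a m : ℕ} (ha : a ∈ S) (ham : ∀ x ∈ S, a ≤ x)
    (hm : m ∈ S) (hmm : ∀ x ∈ S, x ≤ m) : rot S m = a := by
  obtain ⟨i, rfl⟩ := exists_orderIsoOfFin hm
  obtain ⟨j, rfl⟩ := exists_orderIsoOfFin ha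
  have hi : ∀ k, k ≤ i := fun k => by
    have := hmm _ (S.orderIsoOfFin rfl k).2
    exact (S.orderIsoOfFin rfl).le_iff_le.1 this
  have hj : ∀ k, j ≤ k := fun k => by
    have := ham _ (S.orderIsoOfFin rfl k).2
    exact (S.orderIsoOfFin rfl).le_iff_le.1 this
  rw [rot_orderIsoOfFin]
  congr 2
  clear ham hmm ha hm
  generalize S.card = c at *
  cases c with
  | zero => exact i.elim0
  | succ c =>
    have h1 : i = Fin.last c := le_antisymm (Fin.le_last _) (hi _)
    have h2 : j = 0 := le_antisymm (hj _) (Fin.zero_le _)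
    rw [h1, h2, finRotate_last]

theorem rot_between {S : Finset ℕ} {x y : ℕ} (hx : x ∈ S) (hy : y ∈ S) (hxy : x < y) :
    x < rot S x ∧ rot S x ≤ y := by
  obtain ⟨i, rfl⟩ := exists_orderIsoOfFin hx
  obtain ⟨j, rfl⟩ := exists_orderIsoOfFin hy
  rw [rot_orderIsoOfFin]
  have hij : i < j := (S.orderIsoOfFin rfl).lt_iff_lt.1 hxy
  suffices i < finRotate _ i ∧ finRotate _ i ≤ j from
    ⟨(S.orderIsoOfFin rfl).lt_iff_lt.2 this.1, (S.orderIsoOfFin rfl).le_iff_le.2 this.2⟩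
  clear hxy hx hy
  generalize S.card = c at *
  cases c with
  | zero => exact i.elim0
  | succ c =>
    have h : i ≠ Fin.last c := fun h => absurd (Fin.le_last j) (by rw [← h]; exact not_le.2 hij)
    have := coe_finRotate_of_ne_last h
    rw [Fin.lt_def] at hij ⊢
    rw [Fin.le_def]
    omega

theorem rot_mem_iff {S : Finset ℕ} {x : ℕ} : rot S x ∈ S ↔ x ∈ S := by
  refine ⟨fun h => ?_, rot_mem⟩
  by_contra hx
  rw [rot_of_notMem hx] at h
  exact hx h

theorem rot_symm_mem_iff {S : Finset ℕ} {x : ℕ} : (rot S).symm x ∈ S ↔ x ∈ S := by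
  rw [← rot_mem_iff, Equiv.apply_symm_apply]

/-- Permutations of `ℕ` that fix every number `≥ n`. -/
def FixesFrom (n : ℕ) (σ : Equiv.Perm ℕ) : Prop := ∀ i, n ≤ i → σ i = i

theorem FixesFrom.lt_iff {n : ℕ} {σ : Equiv.Perm ℕ} (h : FixesFrom n σ) (i : ℕ) :
    σ i < n ↔ i < n := by
  constructor
  · intro hi
    by_contra h'
    rw [h i (not_lt.1 h')] at hi
    exact h' hi
  · intro hi
    by_contra h'
    have := σ.injective (h (σ i) (not_lt.1 h'))
    omega

theorem FixesFrom.symm_lt_iff {n : ℕ} {σ : Equiv.Perm ℕ} (h : FixesFrom n σ) (i : ℕ) :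
    σ.symm i < n ↔ i < n := by
  rw [← h.lt_iff, Equiv.apply_symm_apply]

/-- A permutation of `Fin n` viewed as a permutation of `ℕ`. -/
def extNat {n : ℕ} (σ : Equiv.Perm (Fin n)) : Equiv.Perm ℕ :=
  σ.extendDomain (Fin.equivSubtype (n := n))

theorem extNat_coe {n : ℕ} (σ : Equiv.Perm (Fin n)) (i : Fin n) :
    extNat σ i = (σ i : ℕ) :=
  Equiv.Perm.extendDomain_apply_image σ (Fin.equivSubtype (n := n)) i

theorem extNat_fixesFrom {n : ℕ} (σ : Equiv.Perm (Fin n)) : FixesFrom n (extNat σ) :=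
  fun _ hi => Equiv.Perm.extendDomain_apply_not_subtype _ _ (not_lt.2 hi)

theorem extNat_injective {n : ℕ} : Function.Injective (extNat (n := n)) :=
  Equiv.Perm.extendDomainHom_injective (Fin.equivSubtype (n := n))

/-- The finite set of permutations of `ℕ` that fix every number `≥ n`. -/
def permsBelow (n : ℕ) : Finset (Equiv.Perm ℕ) := univ.map ⟨extNat (n := n), extNat_injective⟩

theorem card_permsBelow (n : ℕ) : (permsBelow n).card = n.factorial := by
  simp [permsBelow, Fintype.card_perm]

theorem mem_permsBelow {n : ℕ} {σ : Equiv.Perm ℕ} : σ ∈ permsBelow n ↔ FixesFrom n σ := by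
  simp only [permsBelow, mem_map, mem_univ, true_and, Function.Embedding.coeFn_mk]
  constructor
  · rintro ⟨τ, rfl⟩
    exact extNat_fixesFrom τ
  · intro h
    refine ⟨⟨fun i => ⟨σ i, (h.lt_iff i).2 i.2⟩, fun i => ⟨σ.symm i, (h.symm_lt_iff i).2 i.2⟩,
      fun i => by simp, fun i => by simp⟩, ?_⟩
    ext i
    by_cases hi : i < n
    · exact extNat_coe _ ⟨i, hi⟩
    · rw [extNat_fixesFrom _ i (not_lt.1 hi), h i (not_lt.1 hi)]

theorem sum_permsBelow {M : Type*} [AddCommMonoid M] (n : ℕ) (f : Equiv.Perm ℕ → M) :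
    ∑ σ ∈ permsBelow n, f σ = ∑ σ : Equiv.Perm (Fin n), f (extNat σ) := by
  simp [permsBelow]

/-- If inserting the letter `n` in all possible ways changes the pair of statistics `(d, m)` by
adding each `c ≤ n` exactly once to `m`, and by increasing `d` precisely when `c ≥ r + d`, then the
joint distribution of `(d, m)` at level `n + 1` is determined by the one at level `n`. -/
theorem sum_permsBelow_succ {n r : ℕ} {d d' m m' : Equiv.Perm ℕ → ℕ}
    {F : Equiv.Perm ℕ → ℕ → Equiv.Perm ℕ} {inc : Equiv.Perm ℕ → ℕ → ℕ}
    (hF : ∀ σ, FixesFrom n σ → ∀ p ≤ n, FixesFrom (n + 1) (F σ p))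
    (hinj : ∀ σ, FixesFrom n σ → ∀ p ≤ n, ∀ τ, FixesFrom n τ → ∀ q ≤ n, F σ p = F τ q →
      σ = τ ∧ p = q)
    (hm : ∀ σ, FixesFrom n σ → ∀ p ≤ n, m' (F σ p) = m σ + inc σ p)
    (hd : ∀ σ, FixesFrom n σ → ∀ p ≤ n,
      d' (F σ p) = d σ + if r + d σ ≤ inc σ p then 1 else 0)
    (hle : ∀ σ, FixesFrom n σ → ∀ p ≤ n, inc σ p ≤ n)
    (hinc : ∀ σ, FixesFrom n σ → ∀ p ≤ n, ∀ q ≤ n, inc σ p = inc σ q → p = q)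
    (φ : ℕ → ℕ → ℕ) :
    ∑ σ ∈ permsBelow (n + 1), φ (d' σ) (m' σ) =
      ∑ σ ∈ permsBelow n, ∑ c ∈ range (n + 1),
        φ (d σ + if r + d σ ≤ c then 1 else 0) (m σ + c) := by
  classical
  have hInj : Set.InjOn (fun x : Equiv.Perm ℕ × ℕ => F x.1 x.2)
      (permsBelow n ×ˢ range (n + 1) : Finset _) := by
    rintro ⟨σ, p⟩ hσ ⟨τ, q⟩ hτ h
    simp only [coe_product, Set.mem_prod, mem_coe, mem_permsBelow, mem_range,
      Nat.lt_succ_iff] at hσ hτ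
    obtain ⟨rfl, rfl⟩ := hinj σ hσ.1 p hσ.2 τ hτ.1 q hτ.2 h
    rfl
  have himg : (permsBelow n ×ˢ range (n + 1)).image (fun x => F x.1 x.2) =
      permsBelow (n + 1) := by
    apply eq_of_subset_of_card_le
    · intro τ hτ
      simp only [mem_image, mem_product, mem_permsBelow, mem_range, Nat.lt_succ_iff] at hτ
      obtain ⟨⟨σ, p⟩, ⟨hσ, hp⟩, rfl⟩ := hτ
      exact mem_permsBelow.2 (hF σ hσ p hp)
    · rw [card_image_of_injOn hInj, card_product, card_permsBelow, card_permsBelow, card_range,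
        Nat.factorial_succ, mul_comm]
  rw [← himg, sum_image hInj, sum_product]
  refine sum_congr rfl fun σ hσ => ?_
  rw [mem_permsBelow] at hσ
  have hincInj : Set.InjOn (inc σ) (range (n + 1) : Finset ℕ) := by
    intro p hp q hq h
    simp only [coe_range, Set.mem_Iio, Nat.lt_succ_iff] at hp hq
    exact hinc σ hσ p hp q hq h
  have himg' : (range (n + 1)).image (inc σ) = range (n + 1) := by
    apply eq_of_subset_of_card_le
    · intro c hc
      simp only [mem_image, mem_range, Nat.lt_succ_iff] at hc ⊢
      obtain ⟨p, hp, rfl⟩ := hc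
      exact hle σ hσ p hp
    · rw [card_image_of_injOn hincInj]
  conv_rhs => rw [← himg']
  rw [sum_image hincInj]
  refine sum_congr rfl fun p hp => ?_
  rw [mem_range, Nat.lt_succ_iff] at hp
  simp only [hd σ hσ p hp, hm σ hσ p hp]

/-- The number of inversions of the word `σ` restricted to the positions in `A`. -/
def invN (σ : ℕ → ℕ) (A : Finset ℕ) : ℕ :=
  ((A ×ˢ A).filter fun p => p.1 < p.2 ∧ σ p.2 < σ p.1).card

theorem invN_eq_sum (σ : ℕ → ℕ) (A : Finset ℕ) :
    invN σ A = ∑ i ∈ A, ∑ j ∈ A, if i < j ∧ σ j < σ i then 1 else 0 := by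
  rw [invN, card_filter, sum_product]

theorem invN_image {σ τ f : ℕ → ℕ} {A : Finset ℕ} (hf : StrictMonoOn f A)
    (h : ∀ i ∈ A, ∀ j ∈ A, (τ (f j) < τ (f i) ↔ σ j < σ i)) :
    invN τ (A.image f) = invN σ A := by
  rw [invN_eq_sum, invN_eq_sum, sum_image hf.injOn]
  refine sum_congr rfl fun i hi => ?_
  rw [sum_image hf.injOn]
  refine sum_congr rfl fun j hj => ?_
  simp only [hf.lt_iff_lt hi hj, h i hi j hj]

theorem invN_congr {σ τ : ℕ → ℕ} {A : Finset ℕ}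
    (h : ∀ i ∈ A, ∀ j ∈ A, (τ j < τ i ↔ σ j < σ i)) : invN τ A = invN σ A := by
  simpa using invN_image (f := id) (strictMono_id.strictMonoOn _) h

theorem invN_insert (σ : ℕ → ℕ) {A : Finset ℕ} {a : ℕ} (ha : a ∉ A) :
    invN σ (insert a A) = invN σ A + (A.filter fun i => i < a ∧ σ a < σ i).card
      + (A.filter fun i => a < i ∧ σ i < σ a).card := by
  rw [invN_eq_sum, invN_eq_sum, sum_insert ha, sum_insert ha, card_filter, card_filter]
  simp only [sum_insert ha, sum_add_distrib, lt_irrefl, false_and, if_false]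
  ring

theorem invN_union (σ : ℕ → ℕ) {A B : Finset ℕ} (h : ∀ i ∈ A, ∀ j ∈ B, i < j) :
    invN σ (A ∪ B) = invN σ A + invN σ B
      + ∑ j ∈ B, (A.filter fun i => σ j < σ i).card := by
  have hd : Disjoint A B := disjoint_left.2 fun i hA hB => lt_irrefl _ (h i hA i hB)
  rw [invN_eq_sum, invN_eq_sum, invN_eq_sum, sum_union hd]
  simp only [sum_union hd, sum_add_distrib, card_filter]
  have h1 : ∑ i ∈ B, ∑ j ∈ A, (if i < j ∧ σ j < σ i then 1 else 0) = 0 :=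
    sum_eq_zero fun i hi => sum_eq_zero fun j hj => by
      have := h j hj i hi
      rw [if_neg (by omega)]
  have h2 : ∑ i ∈ A, ∑ j ∈ B, (if i < j ∧ σ j < σ i then 1 else 0) =
      ∑ j ∈ B, ∑ i ∈ A, (if σ j < σ i then 1 else 0) := by
    rw [sum_comm]
    refine sum_congr rfl fun j hj => sum_congr rfl fun i hi => ?_
    simp [h i hi j hj]
  rw [h1, h2]
  ring

/-- The elements `≥ k` of `N`, together with `n`. -/
def tail (N : Finset ℕ) (n k : ℕ) : Finset ℕ := insert n (N.filter (k ≤ ·))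

theorem mem_tail {N : Finset ℕ} {n k x : ℕ} : x ∈ tail N n k ↔ x = n ∨ (x ∈ N ∧ k ≤ x) := by
  simp [tail]

theorem self_mem_tail {N : Finset ℕ} {n k : ℕ} : n ∈ tail N n k := by simp [tail]

theorem rot_tail_self_le {N : Finset ℕ} {n k : ℕ} (hN : ∀ x ∈ N, x < n) :
    ∀ x ∈ tail N n k, rot (tail N n k) n ≤ x := by
  have hne : (tail N n k).Nonempty := ⟨n, self_mem_tail⟩
  have : rot (tail N n k) n = (tail N n k).min' hne := by
    refine rot_max (min'_mem _ _) (fun x hx => min'_le _ _ hx) self_mem_tail fun x hx => ?_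
    rcases mem_tail.1 hx with rfl | h
    · exact le_rfl
    · exact (hN x h.1).le
  rw [this]
  exact fun x hx => min'_le _ _ hx

theorem rot_tail_lt {N : Finset ℕ} {n k x : ℕ} (hN : ∀ x ∈ N, x < n) (hx : x ∈ N)
    (hk : x < k) : rot (tail N n k) x = x := by
  apply rot_of_notMem
  rw [mem_tail]
  have := hN x hx
  omega

theorem rot_tail_ge {N : Finset ℕ} {n k x : ℕ} (hN : ∀ x ∈ N, x < n) (hx : x ∈ N)
    (hk : k ≤ x) : x < rot (tail N n k) x ∧ rot (tail N n k) x ≤ n :=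
  rot_between (mem_tail.2 (Or.inr ⟨hx, hk⟩)) self_mem_tail (hN x hx)

theorem le_rot_tail {N : Finset ℕ} {n k x : ℕ} (hN : ∀ x ∈ N, x < n) (hx : x ∈ N) :
    x ≤ rot (tail N n k) x := by
  rcases lt_or_ge x k with h | h
  · rw [rot_tail_lt hN hx h]
  · exact (rot_tail_ge hN hx h).1.le

theorem strictMonoOn_rot_tail {N : Finset ℕ} {n k : ℕ} (hN : ∀ x ∈ N, x < n) :
    StrictMonoOn (rot (tail N n k)) N := by
  intro x hx y hy hxy
  rcases lt_or_ge x k with h | h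
  · rw [rot_tail_lt hN hx h]
    exact hxy.trans_le (le_rot_tail hN hy)
  · have h1 := rot_between (S := tail N n k) (mem_tail.2 (Or.inr ⟨hx, h⟩))
      (mem_tail.2 (Or.inr ⟨hy, h.trans hxy.le⟩)) hxy
    exact h1.2.trans_lt (rot_tail_ge hN hy (h.trans hxy.le)).1

theorem rot_tail_self_notMem_image {N : Finset ℕ} {n k : ℕ} (hN : ∀ x ∈ N, x < n) :
    rot (tail N n k) n ∉ N.image (rot (tail N n k)) := by
  simp only [mem_image, EmbeddingLike.apply_eq_iff_eq, exists_eq_right]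
  exact fun h => lt_irrefl _ (hN n h)

theorem insert_image_rot_tail {N : Finset ℕ} {n k : ℕ} :
    insert (rot (tail N n k) n) (N.image (rot (tail N n k))) = insert n N := by
  rw [← image_insert]
  ext y
  simp only [mem_image]
  constructor
  · rintro ⟨x, hx, rfl⟩
    by_cases h : x ∈ tail N n k
    · have := mem_tail.1 (rot_mem h)
      rw [mem_insert]
      tauto
    · rwa [rot_of_notMem h]
  · intro hy
    refine ⟨(rot (tail N n k)).symm y, ?_, by simp⟩
    by_cases h : y ∈ tail N n k
    · have := mem_tail.1 (rot_symm_mem_iff.2 h)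
      rw [mem_insert]
      tauto
    · rw [← rot_of_notMem h, Equiv.symm_apply_apply]
      exact hy

theorem image_rot_tail {N : Finset ℕ} {n k : ℕ} (hN : ∀ x ∈ N, x < n) :
    N.image (rot (tail N n k)) = (insert n N).erase (rot (tail N n k) n) := by
  rw [← insert_image_rot_tail (k := k), erase_insert (rot_tail_self_notMem_image hN)]

theorem rot_tail_self_lt_iff {N : Finset ℕ} {n k x : ℕ} (hN : ∀ x ∈ N, x < n) (hk : k ≤ n)
    (hx : x ∈ N) : rot (tail N n k) n < rot (tail N n k) x ↔ k ≤ x := by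
  constructor
  · intro h
    by_contra h'
    rw [rot_tail_lt hN hx (not_le.1 h')] at h
    have := mem_tail.1 (rot_mem (self_mem_tail (N := N) (n := n) (k := k)))
    omega
  · intro h
    exact (rot_tail_self_le hN x (mem_tail.2 (Or.inr ⟨hx, h⟩))).trans_lt (rot_tail_ge hN hx h).1

theorem invN_image_rot_tail {N : Finset ℕ} {n k : ℕ} {σ τ : ℕ → ℕ} (hN : ∀ x ∈ N, x < n)
    (h : ∀ x ∈ N, τ (rot (tail N n k) x) = σ x) :
    invN τ (N.image (rot (tail N n k))) = invN σ N :=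
  invN_image (strictMonoOn_rot_tail hN) fun i hi j hj => by rw [h i hi, h j hj]

theorem invN_insert_rot_tail {N : Finset ℕ} {n k v : ℕ} {σ τ : ℕ → ℕ} (hN : ∀ x ∈ N, x < n)
    (hk : k ≤ n) (h : ∀ x ∈ N, τ (rot (tail N n k) x) = σ x)
    (hv : τ (rot (tail N n k) n) = v) (hlt : ∀ x ∈ N, x < k → σ x < v) :
    invN τ (insert n N) = invN σ N + (N.filter fun x => k ≤ x ∧ σ x < v).card := by
  have hinj : Set.InjOn (rot (tail N n k)) N := (rot (tail N n k)).injective.injOn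
  rw [← insert_image_rot_tail (k := k), invN_insert _ (rot_tail_self_notMem_image hN),
    invN_image_rot_tail hN h, hv, filter_image, filter_image,
    card_image_of_injOn (hinj.mono (filter_subset _ _)),
    card_image_of_injOn (hinj.mono (filter_subset _ _))]
  have h1 : (N.filter fun x => rot (tail N n k) x < rot (tail N n k) n ∧
      v < τ (rot (tail N n k) x)) = ∅ := by
    refine filter_eq_empty_iff.2 fun x hx hh => ?_
    rw [h x hx] at hh
    by_cases hkx : k ≤ x
    · have := (rot_tail_self_lt_iff hN hk hx).2 hkx
      omega
    · have := hlt x hx (not_le.1 hkx)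
      omega
  have h2 : (N.filter fun x => rot (tail N n k) n < rot (tail N n k) x ∧
      τ (rot (tail N n k) x) < v) = N.filter fun x => k ≤ x ∧ σ x < v := by
    refine filter_congr fun x hx => ?_
    rw [rot_tail_self_lt_iff hN hk hx, h x hx]
  rw [h1, h2]
  simp

/-- The letter `σ i` at position `i` (both counted from `0`) exceeds its position by at least `g`
and has size at least `r`. -/
def IsExc (g r : ℕ) (σ : ℕ → ℕ) (i : ℕ) : Prop := i + g ≤ σ i ∧ r ≤ σ i

instance (g r : ℕ) (σ : ℕ → ℕ) : DecidablePred (IsExc g r σ) :=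
  fun _ => inferInstanceAs (Decidable (_ ∧ _))

/-- The excedance positions below `n`. -/
def excPos (g r n : ℕ) (σ : ℕ → ℕ) : Finset ℕ := (range n).filter (IsExc g r σ)

/-- The positions below `n` that are not excedance positions. -/
def nexcPos (g r n : ℕ) (σ : ℕ → ℕ) : Finset ℕ := (range n).filter fun i => ¬ IsExc g r σ i

/-- The generalized Denert statistic, positions and letters being counted from `0`. -/
def denN (g r n : ℕ) (σ : ℕ → ℕ) : ℕ :=
  ∑ i ∈ excPos g r n σ, (i + g) + invN σ (excPos g r n σ) + invN σ (nexcPos g r n σ)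

/-- The number of excedance positions that are at least `L`. -/
def excN (g r L n : ℕ) (σ : ℕ → ℕ) : ℕ := ((excPos g r n σ).filter (L ≤ ·)).card

theorem mem_excPos {g r n : ℕ} {σ : ℕ → ℕ} {i : ℕ} :
    i ∈ excPos g r n σ ↔ i < n ∧ IsExc g r σ i := by simp [excPos]

theorem mem_nexcPos {g r n : ℕ} {σ : ℕ → ℕ} {i : ℕ} :
    i ∈ nexcPos g r n σ ↔ i < n ∧ ¬ IsExc g r σ i := by simp [nexcPos]

theorem lt_of_mem_nexcPos {g r n : ℕ} {σ : ℕ → ℕ} : ∀ i ∈ nexcPos g r n σ, i < n :=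
  fun _ hi => (mem_nexcPos.1 hi).1

/-- Insert `n` at the non-excedance position `p`, shifting the later non-excedance letters. -/
def insShift (g r n : ℕ) (σ : Equiv.Perm ℕ) (p : ℕ) : Equiv.Perm ℕ :=
  σ * (rot (tail (nexcPos g r n σ) n p)).symm

theorem insShift_rot (g r n : ℕ) (σ : Equiv.Perm ℕ) (p x : ℕ) :
    insShift g r n σ p (rot (tail (nexcPos g r n σ) n p) x) = σ x := by
  simp [insShift]

section Shift

variable {g r n p : ℕ} {σ : Equiv.Perm ℕ}

theorem not_isExc_self (hg : 1 ≤ g) (hσ : FixesFrom n σ) {x : ℕ} (hx : n ≤ x) :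
    ¬ IsExc g r σ x := by
  rintro ⟨h, -⟩
  rw [hσ x hx] at h
  omega

theorem isExc_lt (hg : 1 ≤ g) (hσ : FixesFrom n σ) {x : ℕ} (hx : IsExc g r σ x) : x + g < n := by
  have h1 : x < n := by
    by_contra h
    exact not_isExc_self hg hσ (not_lt.1 h) hx
  have := hx.1
  have := (hσ.lt_iff x).2 h1
  omega

theorem rot_tail_nexcPos_self (hp : p ≤ n) (hX : ¬ IsExc g r σ p) :
    rot (tail (nexcPos g r n σ) n p) n = p := by
  refine rot_max ?_ ?_ self_mem_tail ?_
  · rw [mem_tail, mem_nexcPos]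
    rcases hp.lt_or_eq with h | h
    · exact Or.inr ⟨⟨h, hX⟩, le_rfl⟩
    · exact Or.inl h
  · intro x hx
    rcases mem_tail.1 hx with rfl | h
    · exact hp
    · exact h.2
  · intro x hx
    rcases mem_tail.1 hx with rfl | h
    · exact le_rfl
    · exact (mem_nexcPos.1 h.1).1.le

theorem insShift_self (hσ : FixesFrom n σ) (hp : p ≤ n) (hX : ¬ IsExc g r σ p) :
    insShift g r n σ p p = n := by
  have := insShift_rot g r n σ p n
  rwa [rot_tail_nexcPos_self hp hX, hσ n le_rfl] at this

theorem fixesFrom_rot_tail {N : Finset ℕ} {k : ℕ} (hN : ∀ x ∈ N, x < n) :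
    FixesFrom (n + 1) (rot (tail N n k)) := by
  intro i hi
  apply rot_of_notMem
  rw [mem_tail]
  intro h
  rcases h with h | h
  · omega
  · have := hN i h.1
    omega

theorem FixesFrom.mul {σ τ : Equiv.Perm ℕ} (h : FixesFrom n σ) (h' : FixesFrom n τ) :
    FixesFrom n (σ * τ) := fun i hi => by
  rw [Equiv.Perm.mul_apply, h' i hi, h i hi]

theorem FixesFrom.symm {σ : Equiv.Perm ℕ} (h : FixesFrom n σ) : FixesFrom n σ.symm :=
  fun i hi => by rw [Equiv.symm_apply_eq, h i hi]

theorem FixesFrom.succ {σ : Equiv.Perm ℕ} (h : FixesFrom n σ) : FixesFrom (n + 1) σ :=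
  fun i hi => h i (by omega)

theorem insShift_fixesFrom (hσ : FixesFrom n σ) : FixesFrom (n + 1) (insShift g r n σ p) :=
  hσ.succ.mul (fixesFrom_rot_tail lt_of_mem_nexcPos).symm

theorem insShift_of_isExc {x : ℕ} (hg : 1 ≤ g) (hσ : FixesFrom n σ) (hx : IsExc g r σ x) :
    insShift g r n σ p x = σ x := by
  have h : rot (tail (nexcPos g r n σ) n p) x = x := by
    apply rot_of_notMem
    rw [mem_tail, mem_nexcPos]
    have := isExc_lt hg hσ hx
    rintro (h | h)
    · omega
    · exact h.1.2 hx
  conv_lhs => rw [← h]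
  exact insShift_rot g r n σ p x

theorem not_isExc_of_le {σ τ : ℕ → ℕ} {x y : ℕ} (hx : ¬ IsExc g r σ x) (hxy : x ≤ y)
    (h : τ y = σ x) : ¬ IsExc g r τ y := by
  rintro ⟨h1, h2⟩
  exact hx ⟨by omega, by omega⟩

theorem isExc_insShift_iff (hg : 1 ≤ g) (hr : r ≤ n) (hσ : FixesFrom n σ) (hp : p ≤ n)
    (hX : ¬ IsExc g r σ p) {y : ℕ} (hy : y ≤ n) :
    IsExc g r (insShift g r n σ p) y ↔ IsExc g r σ y ∨ (y = p ∧ p + g ≤ n) := by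
  by_cases h : IsExc g r σ y
  · simp only [h, true_or, iff_true]
    unfold IsExc at h ⊢
    rwa [insShift_of_isExc hg hσ h]
  · simp only [h, false_or]
    by_cases hyp : y = p
    · subst hyp
      rw [IsExc, insShift_self hσ hy hX]
      tauto
    · simp only [hyp, false_and, iff_false]
      have hmem : y ∈ (insert n (nexcPos g r n σ)).erase
          (rot (tail (nexcPos g r n σ) n p) n) := by
        rw [rot_tail_nexcPos_self hp hX, mem_erase, mem_insert, mem_nexcPos]
        refine ⟨hyp, ?_⟩
        rcases hy.lt_or_eq with h' | h'
        · exact Or.inr ⟨h', h⟩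
        · exact Or.inl h'
      rw [← image_rot_tail lt_of_mem_nexcPos, mem_image] at hmem
      obtain ⟨x, hx, rfl⟩ := hmem
      exact not_isExc_of_le (mem_nexcPos.1 hx).2 (le_rot_tail lt_of_mem_nexcPos hx)
        (insShift_rot g r n σ p x)

theorem excPos_insShift_of_le (hg : 1 ≤ g) (hr : r ≤ n) (hσ : FixesFrom n σ) (hp : p + g ≤ n)
    (hX : ¬ IsExc g r σ p) :
    excPos g r (n + 1) (insShift g r n σ p) = insert p (excPos g r n σ) := by
  ext y
  rw [mem_insert, mem_excPos, mem_excPos]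
  constructor
  · rintro ⟨h1, h2⟩
    rw [isExc_insShift_iff hg hr hσ (by omega) hX (by omega)] at h2
    rcases h2 with h2 | h2
    · have := isExc_lt hg hσ h2
      exact Or.inr ⟨by omega, h2⟩
    · exact Or.inl h2.1
  · rintro (rfl | ⟨h1, h2⟩)
    · exact ⟨by omega, (isExc_insShift_iff hg hr hσ (by omega) hX (by omega)).2 (Or.inr ⟨rfl, hp⟩)⟩
    · exact ⟨by omega, (isExc_insShift_iff hg hr hσ (by omega) hX (by omega)).2 (Or.inl h2)⟩

theorem excPos_insShift_of_lt (hg : 1 ≤ g) (hr : r ≤ n) (hσ : FixesFrom n σ) (hp : p ≤ n)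
    (hpg : n < p + g) (hX : ¬ IsExc g r σ p) :
    excPos g r (n + 1) (insShift g r n σ p) = excPos g r n σ := by
  ext y
  rw [mem_excPos, mem_excPos]
  constructor
  · rintro ⟨h1, h2⟩
    rw [isExc_insShift_iff hg hr hσ hp hX (by omega)] at h2
    rcases h2 with h2 | h2
    · have := isExc_lt hg hσ h2
      exact ⟨by omega, h2⟩
    · omega
  · rintro ⟨h1, h2⟩
    exact ⟨by omega, (isExc_insShift_iff hg hr hσ hp hX (by omega)).2 (Or.inl h2)⟩

theorem nexcPos_eq_sdiff (g r n : ℕ) (σ : ℕ → ℕ) :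
    nexcPos g r n σ = range n \ excPos g r n σ := by
  ext y
  simp only [mem_nexcPos, mem_sdiff, mem_range, mem_excPos]
  tauto

theorem nexcPos_insShift_of_le (hg : 1 ≤ g) (hr : r ≤ n) (hσ : FixesFrom n σ) (hp : p + g ≤ n)
    (hX : ¬ IsExc g r σ p) :
    nexcPos g r (n + 1) (insShift g r n σ p) =
      (nexcPos g r n σ).image (rot (tail (nexcPos g r n σ) n p)) := by
  rw [image_rot_tail lt_of_mem_nexcPos, rot_tail_nexcPos_self (by omega) hX, nexcPos_eq_sdiff,
    excPos_insShift_of_le hg hr hσ hp hX]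
  ext y
  simp only [mem_sdiff, mem_range, mem_insert, mem_erase, mem_excPos, mem_nexcPos]
  by_cases h : y = n
  · subst h
    have := not_isExc_self (r := r) hg hσ le_rfl
    simp [this]
  · have : y < n + 1 ↔ y < n := by omega
    rw [this]
    tauto

theorem nexcPos_of_excPos_eq {σ τ : ℕ → ℕ} (h : excPos g r (n + 1) τ = excPos g r n σ) :
    nexcPos g r (n + 1) τ = insert n (nexcPos g r n σ) := by
  rw [nexcPos_eq_sdiff, h]
  ext y
  simp only [mem_sdiff, mem_range, mem_insert, mem_excPos, mem_nexcPos]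
  by_cases hy : y = n
  · subst hy
    simp
  · have : y < n + 1 ↔ y < n := by omega
    rw [this]
    tauto

theorem denN_insShift_of_le (hg : 1 ≤ g) (hr : r ≤ n) (hσ : FixesFrom n σ) (hp : p + g ≤ n)
    (hX : ¬ IsExc g r σ p) :
    denN g r (n + 1) (insShift g r n σ p) =
      denN g r n σ + (p + g + ((excPos g r n σ).filter (p < ·)).card) := by
  have hpE : p ∉ excPos g r n σ := fun h => hX (mem_excPos.1 h).2
  have hE : ∀ i ∈ excPos g r n σ, insShift g r n σ p i = σ i := fun i hi =>
    insShift_of_isExc hg hσ (mem_excPos.1 hi).2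
  have h1 : ((excPos g r n σ).filter fun i =>
      i < p ∧ insShift g r n σ p p < insShift g r n σ p i) = ∅ := by
    refine filter_eq_empty_iff.2 fun i hi hh => ?_
    rw [hE i hi, insShift_self hσ (by omega) hX] at hh
    have := (hσ.lt_iff i).2 (mem_excPos.1 hi).1
    omega
  have h2 : ((excPos g r n σ).filter fun i =>
      p < i ∧ insShift g r n σ p i < insShift g r n σ p p) = (excPos g r n σ).filter (p < ·) := by
    refine filter_congr fun i hi => ?_
    rw [hE i hi, insShift_self hσ (by omega) hX]
    have := (hσ.lt_iff i).2 (mem_excPos.1 hi).1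
    omega
  rw [denN, excPos_insShift_of_le hg hr hσ hp hX, nexcPos_insShift_of_le hg hr hσ hp hX,
    invN_image_rot_tail lt_of_mem_nexcPos fun x _ => insShift_rot g r n σ p x,
    invN_insert _ hpE, h1, h2, sum_insert hpE,
    invN_congr fun i hi j hj => by rw [hE i hi, hE j hj], denN]
  simp
  ring

theorem denN_insShift_of_lt (hg : 1 ≤ g) (hr : r ≤ n) (hσ : FixesFrom n σ) (hp : p ≤ n)
    (hpg : n < p + g) (hX : ¬ IsExc g r σ p) :
    denN g r (n + 1) (insShift g r n σ p) = denN g r n σ + (n - p) := by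
  have hE : ∀ i ∈ excPos g r n σ, insShift g r n σ p i = σ i := fun i hi =>
    insShift_of_isExc hg hσ (mem_excPos.1 hi).2
  have hExc := excPos_insShift_of_lt hg hr hσ hp hpg hX
  have h1 : ((nexcPos g r n σ).filter fun x => p ≤ x ∧ σ x < n) = Ico p n := by
    ext x
    simp only [mem_filter, mem_nexcPos, mem_Ico]
    constructor
    · tauto
    · intro h
      refine ⟨⟨h.2, fun h' => ?_⟩, h.1, (hσ.lt_iff x).2 h.2⟩
      have := isExc_lt hg hσ h'
      omega
  have h2 := invN_insert_rot_tail (N := nexcPos g r n σ) (τ := insShift g r n σ p) (σ := σ)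
    lt_of_mem_nexcPos hp (fun x _ => insShift_rot g r n σ p x) (v := n)
    (by rw [rot_tail_nexcPos_self hp hX, insShift_self hσ hp hX])
    (fun x hx _ => (hσ.lt_iff x).2 (mem_nexcPos.1 hx).1)
  rw [h1, Nat.card_Ico] at h2
  rw [denN, nexcPos_of_excPos_eq hExc, hExc, h2,
    invN_congr fun i hi j hj => by rw [hE i hi, hE j hj], denN]
  ring

end Shift

theorem card_filter_range_eq (g r n : ℕ) (σ : ℕ → ℕ) (P : ℕ → Prop) [DecidablePred P] :
    ((range n).filter P).card =
      ((excPos g r n σ).filter P).card + ((nexcPos g r n σ).filter P).card := by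
  rw [← card_filter_add_card_filter_not (s := (range n).filter P) (IsExc g r σ), excPos, nexcPos,
    filter_filter, filter_filter, filter_filter, filter_filter]
  simp only [and_comm]

/-- The letters below `n` at positions `i` with `i + g ≤ e`. -/
def lowLetters (g n : ℕ) (σ : Equiv.Perm ℕ) (e : ℕ) : Finset ℕ :=
  (range n).filter fun v => σ.symm v + g ≤ e

/-- Raise the letters `≥ e` at positions `i` with `i + g ≤ e` to the next one of these letters
(the largest one to `n`), and insert `e` at the first non-excedance position `i` with `e < i + g`,
shifting the later non-excedance letters. -/
def insRaise (g r n : ℕ) (σ : Equiv.Perm ℕ) (e : ℕ) : Equiv.Perm ℕ :=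
  rot (tail (lowLetters g n σ e) n e) * σ * (rot (tail (nexcPos g r n σ) n (e + 1 - g))).symm

theorem insRaise_rot (g r n : ℕ) (σ : Equiv.Perm ℕ) (e x : ℕ) :
    insRaise g r n σ e (rot (tail (nexcPos g r n σ) n (e + 1 - g)) x) =
      rot (tail (lowLetters g n σ e) n e) (σ x) := by
  simp [insRaise]

theorem mem_lowLetters {g n e v : ℕ} {σ : Equiv.Perm ℕ} :
    v ∈ lowLetters g n σ e ↔ v < n ∧ σ.symm v + g ≤ e := by simp [lowLetters]

theorem lt_of_mem_lowLetters {g n e : ℕ} {σ : Equiv.Perm ℕ} : ∀ v ∈ lowLetters g n σ e, v < n :=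
  fun _ hv => (mem_lowLetters.1 hv).1

section Raise

variable {g r n p e : ℕ} {σ : Equiv.Perm ℕ}

theorem isExc_apply_lt (hg : 1 ≤ g) (hσ : FixesFrom n σ) (hX : IsExc g r σ p) : σ p < n := by
  have := isExc_lt hg hσ hX
  exact (hσ.lt_iff p).2 (by omega)

theorem rot_tail_lowLetters_self (hg : 1 ≤ g) (hσ : FixesFrom n σ) (hX : IsExc g r σ p) :
    rot (tail (lowLetters g n σ (σ p)) n (σ p)) n = σ p := by
  have := isExc_apply_lt hg hσ hX
  refine rot_max ?_ ?_ self_mem_tail ?_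
  · rw [mem_tail, mem_lowLetters, Equiv.symm_apply_apply]
    exact Or.inr ⟨⟨this, hX.1⟩, le_rfl⟩
  · intro x hx
    rcases mem_tail.1 hx with rfl | h
    · omega
    · exact h.2
  · intro x hx
    rcases mem_tail.1 hx with rfl | h
    · exact le_rfl
    · exact (lt_of_mem_lowLetters x h.1).le

theorem insRaise_rot_self (hg : 1 ≤ g) (hσ : FixesFrom n σ) (hX : IsExc g r σ p) :
    insRaise g r n σ (σ p) (rot (tail (nexcPos g r n σ) n (σ p + 1 - g)) n) = σ p := by
  rw [insRaise_rot, hσ n le_rfl, rot_tail_lowLetters_self hg hσ hX]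

theorem insRaise_fixesFrom (hσ : FixesFrom n σ) : FixesFrom (n + 1) (insRaise g r n σ e) :=
  ((fixesFrom_rot_tail lt_of_mem_lowLetters).mul hσ.succ).mul
    (fixesFrom_rot_tail lt_of_mem_nexcPos).symm

theorem insRaise_rot_of_mem (hσ : FixesFrom n σ) (he : r ≤ e) {x : ℕ}
    (hx : x ∈ nexcPos g r n σ) :
    insRaise g r n σ e (rot (tail (nexcPos g r n σ) n (e + 1 - g)) x) = σ x := by
  rw [insRaise_rot]
  apply rot_of_notMem
  rw [mem_tail, mem_lowLetters, Equiv.symm_apply_apply]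
  obtain ⟨h1, h2⟩ := mem_nexcPos.1 hx
  have := (hσ.lt_iff x).2 h1
  rintro (h | h)
  · omega
  · exact h2 ⟨by omega, by omega⟩

theorem insRaise_of_isExc (hg : 1 ≤ g) (hσ : FixesFrom n σ) {x : ℕ} (hx : IsExc g r σ x) :
    insRaise g r n σ e x = rot (tail (lowLetters g n σ e) n e) (σ x) := by
  have h : rot (tail (nexcPos g r n σ) n (e + 1 - g)) x = x := by
    apply rot_of_notMem
    rw [mem_tail, mem_nexcPos]
    have := isExc_lt hg hσ hx
    rintro (h | h)
    · omega
    · exact h.1.2 hx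
  conv_lhs => rw [← h]
  exact insRaise_rot g r n σ e x

theorem insRaise_of_isExc_of_lt (hg : 1 ≤ g) (hσ : FixesFrom n σ) {x : ℕ} (hx : IsExc g r σ x)
    (h : e < x + g ∨ σ x < e) : insRaise g r n σ e x = σ x := by
  rw [insRaise_of_isExc hg hσ hx]
  apply rot_of_notMem
  rw [mem_tail, mem_lowLetters, Equiv.symm_apply_apply]
  have := isExc_apply_lt hg hσ hx
  omega

theorem lt_insRaise_of_isExc (hg : 1 ≤ g) (hσ : FixesFrom n σ) {x : ℕ} (hx : IsExc g r σ x)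
    (h : x + g ≤ e) (h' : e ≤ σ x) :
    σ x < insRaise g r n σ e x ∧ insRaise g r n σ e x ≤ n := by
  rw [insRaise_of_isExc hg hσ hx]
  refine rot_tail_ge lt_of_mem_lowLetters ?_ h'
  rw [mem_lowLetters, Equiv.symm_apply_apply]
  exact ⟨isExc_apply_lt hg hσ hx, h⟩

theorem le_insRaise_of_isExc (hg : 1 ≤ g) (hσ : FixesFrom n σ) {x : ℕ} (hx : IsExc g r σ x) :
    σ x ≤ insRaise g r n σ e x := by
  rcases lt_or_ge e (x + g) with h | h
  · rw [insRaise_of_isExc_of_lt hg hσ hx (Or.inl h)]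
  · rcases lt_or_ge (σ x) e with h' | h'
    · rw [insRaise_of_isExc_of_lt hg hσ hx (Or.inr h')]
    · exact (lt_insRaise_of_isExc hg hσ hx h h').1.le

theorem lt_rot_tail_nexcPos_self (he : e < n) (hg : 1 ≤ g) :
    e < rot (tail (nexcPos g r n σ) n (e + 1 - g)) n + g := by
  rcases mem_tail.1 (rot_mem (self_mem_tail (N := nexcPos g r n σ) (n := n) (k := e + 1 - g)))
    with h | h
  · rw [h]
    omega
  · omega

theorem isExc_insRaise_iff (hg : 1 ≤ g) (hσ : FixesFrom n σ) (hX : IsExc g r σ p)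
    {y : ℕ} (hy : y ≤ n) :
    IsExc g r (insRaise g r n σ (σ p)) y ↔ IsExc g r σ y := by
  by_cases h : IsExc g r σ y
  · simp only [h, iff_true]
    have := le_insRaise_of_isExc (e := σ p) hg hσ h
    exact ⟨h.1.trans this, h.2.trans this⟩
  · simp only [h, iff_false]
    have hmem : y ∈ insert n (nexcPos g r n σ) := by
      rw [mem_insert, mem_nexcPos]
      rcases hy.lt_or_eq with h' | h'
      · exact Or.inr ⟨h', h⟩
      · exact Or.inl h'
    rw [← insert_image_rot_tail (k := σ p + 1 - g), mem_insert, mem_image] at hmem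
    rcases hmem with rfl | ⟨x, hx, rfl⟩
    · rintro ⟨h1, -⟩
      rw [insRaise_rot_self hg hσ hX] at h1
      have := lt_rot_tail_nexcPos_self (r := r) (σ := σ) (isExc_apply_lt hg hσ hX) hg
      omega
    · exact not_isExc_of_le (mem_nexcPos.1 hx).2 (le_rot_tail lt_of_mem_nexcPos hx)
        (insRaise_rot_of_mem hσ hX.2 hx)

theorem excPos_insRaise (hg : 1 ≤ g) (hσ : FixesFrom n σ) (hX : IsExc g r σ p) :
    excPos g r (n + 1) (insRaise g r n σ (σ p)) = excPos g r n σ := by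
  ext y
  rw [mem_excPos, mem_excPos]
  constructor
  · rintro ⟨h1, h2⟩
    rw [isExc_insRaise_iff hg hσ hX (by omega)] at h2
    have := isExc_lt hg hσ h2
    exact ⟨by omega, h2⟩
  · rintro ⟨h1, h2⟩
    exact ⟨by omega, (isExc_insRaise_iff hg hσ hX (by omega)).2 h2⟩

theorem card_filter_lowLetters (hσ : FixesFrom n σ) (he : r ≤ e) (P : ℕ → Prop)
    [DecidablePred P] (hP : ∀ v, v ∈ lowLetters g n σ e → P v → e ≤ v) :
    (((excPos g r n σ).filter (· + g ≤ e)).filter fun x => P (σ x)).card =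
      ((lowLetters g n σ e).filter P).card := by
  rw [← card_image_of_injective _ σ.injective]
  congr 1
  ext v
  simp only [mem_image, mem_filter, mem_excPos]
  constructor
  · rintro ⟨x, ⟨⟨⟨h1, h2⟩, h3⟩, h4⟩, rfl⟩
    refine ⟨mem_lowLetters.2 ⟨(hσ.lt_iff x).2 h1, ?_⟩, h4⟩
    rwa [Equiv.symm_apply_apply]
  · rintro ⟨h1, h2⟩
    have h3 := hP v h1 h2
    rw [mem_lowLetters] at h1
    refine ⟨σ.symm v, ⟨⟨⟨(hσ.symm_lt_iff v).2 h1.1, ?_⟩, h1.2⟩, ?_⟩, by simp⟩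
    · rw [IsExc, Equiv.apply_symm_apply]
      omega
    · rwa [Equiv.apply_symm_apply]

theorem card_filter_lt_insRaise (hg : 1 ≤ g) (hσ : FixesFrom n σ) (hX : IsExc g r σ p) {w : ℕ}
    (hw : σ p < w) (hwn : w < n) :
    (((excPos g r n σ).filter (· + g ≤ σ p)).filter fun x =>
      w < insRaise g r n σ (σ p) x).card =
    (((excPos g r n σ).filter (· + g ≤ σ p)).filter fun x => w < σ x).card + 1 := by
  set e := σ p with he
  set f := rot (tail (lowLetters g n σ e) n e) with hf
  have h1 := card_filter_lowLetters (g := g) hσ hX.2 (fun v => w < f v) (by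
    intro v hv h
    by_contra h'
    rw [hf, rot_tail_lt lt_of_mem_lowLetters hv (not_le.1 h')] at h
    omega)
  have h2 := card_filter_lowLetters (g := g) hσ hX.2 (fun v => w < v) (fun v _ h => by omega)
  have h3 : (((excPos g r n σ).filter (· + g ≤ e)).filter fun x => w < insRaise g r n σ e x) =
      (((excPos g r n σ).filter (· + g ≤ e)).filter fun x => w < f (σ x)) := by
    refine filter_congr fun x hx => ?_
    rw [insRaise_of_isExc hg hσ (mem_excPos.1 (mem_filter.1 hx).1).2]
  rw [h3]
  simp only [← he] at h1 h2
  rw [h1, h2, ← card_image_of_injective _ f.injective,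
    show (((lowLetters g n σ e).filter fun v => w < f v).image f) =
      ((lowLetters g n σ e).image f).filter (w < ·) by rw [filter_image],
    image_rot_tail lt_of_mem_lowLetters, rot_tail_lowLetters_self hg hσ hX]
  rw [← card_insert_of_notMem (a := n) fun h =>
    lt_irrefl _ (lt_of_mem_lowLetters n (mem_filter.1 h).1)]
  congr 1
  ext v
  simp only [mem_filter, mem_erase, mem_insert, ← he]
  constructor
  · tauto
  · rintro (rfl | h)
    · exact ⟨⟨by omega, Or.inl rfl⟩, hwn⟩
    · exact ⟨⟨by omega, Or.inr h.1⟩, h.2⟩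

theorem invN_excPos_insRaise (hg : 1 ≤ g) (hσ : FixesFrom n σ) (hX : IsExc g r σ p) :
    invN (insRaise g r n σ (σ p)) (excPos g r n σ) =
      invN σ (excPos g r n σ) + ((excPos g r n σ).filter (σ p < · + g)).card := by
  set Q := (excPos g r n σ).filter (· + g ≤ σ p) with hQ
  set R := (excPos g r n σ).filter (σ p < · + g) with hR
  have hE : excPos g r n σ = Q ∪ R := by
    ext x
    simp only [hQ, hR, mem_union, mem_filter]
    rcases le_or_gt (x + g) (σ p) with h | h
    · simp [h]
    · simp [h]
  have hQR : ∀ i ∈ Q, ∀ j ∈ R, i < j := fun i hi j hj => by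
    have := (mem_filter.1 hi).2
    have := (mem_filter.1 hj).2
    omega
  have hRv : ∀ z ∈ R, insRaise g r n σ (σ p) z = σ z := fun z hz =>
    insRaise_of_isExc_of_lt hg hσ (mem_excPos.1 (mem_filter.1 hz).1).2
      (Or.inl (mem_filter.1 hz).2)
  have hcross : ∑ z ∈ R, (Q.filter fun x =>
        insRaise g r n σ (σ p) z < insRaise g r n σ (σ p) x).card =
      ∑ z ∈ R, ((Q.filter fun x => σ z < σ x).card + 1) := by
    refine sum_congr rfl fun z hz => ?_
    have hz' := mem_filter.1 hz
    have hzX := (mem_excPos.1 hz'.1).2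
    simp only [hRv z hz]
    exact card_filter_lt_insRaise hg hσ hX (hz'.2.trans_le hzX.1) (isExc_apply_lt hg hσ hzX)
  have hQi : invN (insRaise g r n σ (σ p)) Q = invN σ Q := by
    refine invN_congr fun i hi j hj => ?_
    have hlow : ∀ i ∈ Q, σ i ∈ lowLetters g n σ (σ p) := fun i hi => by
      have hi' := mem_filter.1 hi
      rw [mem_lowLetters, Equiv.symm_apply_apply]
      exact ⟨isExc_apply_lt hg hσ (mem_excPos.1 hi'.1).2, hi'.2⟩
    rw [insRaise_of_isExc hg hσ (mem_excPos.1 (mem_filter.1 hi).1).2,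
      insRaise_of_isExc hg hσ (mem_excPos.1 (mem_filter.1 hj).1).2]
    exact (strictMonoOn_rot_tail lt_of_mem_lowLetters).lt_iff_lt (hlow j hj) (hlow i hi)
  have hRi : invN (insRaise g r n σ (σ p)) R = invN σ R :=
    invN_congr fun i hi j hj => by rw [hRv i hi, hRv j hj]
  rw [hE, invN_union _ hQR, invN_union _ hQR, hQi, hRi, hcross, sum_add_distrib]
  simp
  ring

theorem card_filter_apply_lt (hσ : FixesFrom n σ) (he : e ≤ n) :
    ((range n).filter fun x => σ x < e).card = e := by
  rw [← card_image_of_injective _ σ.injective]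
  conv_rhs => rw [← card_range e]
  congr 1
  ext v
  simp only [mem_image, mem_filter, mem_range]
  constructor
  · rintro ⟨x, ⟨-, h⟩, rfl⟩
    exact h
  · intro h
    exact ⟨σ.symm v, ⟨(hσ.symm_lt_iff v).2 (by omega), by simpa using h⟩, by simp⟩

theorem card_raise (hg : 1 ≤ g) (hσ : FixesFrom n σ) (hX : IsExc g r σ p) :
    ((excPos g r n σ).filter (σ p < · + g)).card +
      ((nexcPos g r n σ).filter fun x => σ p + 1 - g ≤ x ∧ σ x < σ p).card =
    g + ((excPos g r n σ).filter (σ p < σ ·)).card := by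
  have hen := isExc_apply_lt hg hσ hX
  have hpg := hX.1
  have hpE : p ∈ excPos g r n σ := by
    have := isExc_lt hg hσ hX
    exact mem_excPos.2 ⟨by omega, hX⟩
  have h1 := card_filter_range_eq g r n σ (σ · < σ p)
  rw [card_filter_apply_lt hσ hen.le] at h1
  have h2 := card_filter_range_eq g r n σ (· + g ≤ σ p)
  have h2' : (range n).filter (· + g ≤ σ p) = range (σ p + 1 - g) := by
    ext x
    simp only [mem_filter, mem_range]
    omega
  rw [h2', card_range] at h2
  have h3 := card_filter_add_card_filter_not (s := excPos g r n σ) (· + g ≤ σ p)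
  simp only [not_le] at h3
  have h4 := card_filter_add_card_filter_not (s := excPos g r n σ) (σ · < σ p)
  have h5 : ((excPos g r n σ).filter fun x => ¬ σ x < σ p) =
      insert p ((excPos g r n σ).filter (σ p < σ ·)) := by
    ext x
    simp only [mem_filter, mem_insert]
    constructor
    · rintro ⟨ha, hb⟩
      rcases (not_lt.1 hb).lt_or_eq with h | h
      · exact Or.inr ⟨ha, h⟩
      · exact Or.inl (σ.injective h.symm)
    · rintro (rfl | ⟨ha, hb⟩)
      · exact ⟨hpE, by omega⟩
      · exact ⟨ha, by omega⟩
  rw [h5, card_insert_of_notMem (by simp)] at h4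
  have h6 := card_filter_add_card_filter_not
    (s := (nexcPos g r n σ).filter (σ · < σ p)) (· + g ≤ σ p)
  rw [filter_filter, filter_filter] at h6
  have h7 : ((nexcPos g r n σ).filter fun x => σ x < σ p ∧ x + g ≤ σ p) =
      (nexcPos g r n σ).filter (· + g ≤ σ p) := by
    refine filter_congr fun x hx => and_iff_right_of_imp fun h => ?_
    by_contra h'
    have := hX.2
    exact (mem_nexcPos.1 hx).2 ⟨by omega, by omega⟩
  have h8 : ((nexcPos g r n σ).filter fun x => σ x < σ p ∧ ¬ x + g ≤ σ p) =
      (nexcPos g r n σ).filter fun x => σ p + 1 - g ≤ x ∧ σ x < σ p := by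
    refine filter_congr fun x hx => ?_
    omega
  rw [h7, h8] at h6
  omega

theorem denN_insRaise (hg : 1 ≤ g) (hσ : FixesFrom n σ) (hX : IsExc g r σ p) :
    denN g r (n + 1) (insRaise g r n σ (σ p)) =
      denN g r n σ + (g + ((excPos g r n σ).filter (σ p < σ ·)).card) := by
  have hen := isExc_apply_lt hg hσ hX
  have hExc := excPos_insRaise hg hσ hX
  have h2 := invN_insert_rot_tail (N := nexcPos g r n σ) (τ := insRaise g r n σ (σ p)) (σ := σ)
    (k := σ p + 1 - g) lt_of_mem_nexcPos (by omega)
    (fun x hx => insRaise_rot_of_mem hσ hX.2 hx) (insRaise_rot_self hg hσ hX)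
    (fun x hx hxk => by
      by_contra h'
      have := hX.2
      exact (mem_nexcPos.1 hx).2 ⟨by omega, by omega⟩)
  rw [denN, nexcPos_of_excPos_eq hExc, hExc, h2, invN_excPos_insRaise hg hσ hX,
    ← card_raise hg hσ hX, denN]
  ring

end Raise

/-- Insertion of `n` at `p`: a shift when `p` is not an excedance position, a raise of letters
otherwise. -/
def insExc (g r n : ℕ) (σ : Equiv.Perm ℕ) (p : ℕ) : Equiv.Perm ℕ :=
  if IsExc g r σ p then insRaise g r n σ (σ p) else insShift g r n σ p

/-- The amount by which `insExc` increases the Denert statistic. -/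
def denInc (g r n : ℕ) (σ : Equiv.Perm ℕ) (p : ℕ) : ℕ :=
  if IsExc g r σ p then g + ((excPos g r n σ).filter (σ p < σ ·)).card
  else if p + g ≤ n then p + g + ((excPos g r n σ).filter (p < ·)).card
  else n - p

/-- The letter `y` occupies, in `τ`, the first non-excedance position at which it is not an
excedance letter, and it would be an excedance letter at the position of `n`. -/
def Tight (g r n : ℕ) (τ : Equiv.Perm ℕ) (y : ℕ) : Prop :=
  y < n ∧ r ≤ y ∧ τ.symm n + g ≤ y ∧ ¬ IsExc g r τ (τ.symm y) ∧
    ∀ x < τ.symm y, ¬ IsExc g r τ x → x + g ≤ y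

section Insertion

variable {g r n p : ℕ} {σ : Equiv.Perm ℕ}

theorem insExc_fixesFrom (hσ : FixesFrom n σ) : FixesFrom (n + 1) (insExc g r n σ p) := by
  unfold insExc
  split_ifs
  · exact insRaise_fixesFrom hσ
  · exact insShift_fixesFrom hσ

theorem denN_insExc (hg : 1 ≤ g) (hr : r ≤ n) (hσ : FixesFrom n σ) (hp : p ≤ n) :
    denN g r (n + 1) (insExc g r n σ p) = denN g r n σ + denInc g r n σ p := by
  unfold insExc denInc
  split_ifs with h h'
  · exact denN_insRaise hg hσ h
  · exact denN_insShift_of_le hg hr hσ h' h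
  · exact denN_insShift_of_lt hg hr hσ hp (not_le.1 h') h

theorem card_filter_apply_gt_lt (hg : 1 ≤ g) (hσ : FixesFrom n σ) (hX : IsExc g r σ p) :
    ((excPos g r n σ).filter (σ p < σ ·)).card < (excPos g r n σ).card := by
  refine card_lt_card (filter_ssubset.2 ⟨p, ?_, lt_irrefl _⟩)
  have := isExc_lt hg hσ hX
  exact mem_excPos.2 ⟨by omega, hX⟩

theorem card_excPos_le (hg : 1 ≤ g) (hσ : FixesFrom n σ) : (excPos g r n σ).card ≤ n - g := by
  rw [← card_range (n - g)]
  refine card_le_card fun x hx => ?_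
  have := isExc_lt hg hσ (mem_excPos.1 hx).2
  rw [mem_range]
  omega

theorem card_filter_le_add {E : Finset ℕ} {a b : ℕ} (c : ℕ) (hab : a ≤ c) (hcb : c ∉ E)
    (hbc : b = c) : (E.filter (a ≤ ·)).card ≤ (E.filter (b < ·)).card + (c - a) := by
  subst hbc
  rw [← Nat.card_Ico]
  refine le_trans (card_le_card fun x hx => ?_) (card_union_le _ _)
  rw [mem_filter] at hx
  rw [mem_union, mem_filter, mem_Ico]
  rcases lt_trichotomy x b with h | h | h
  · exact Or.inr ⟨hx.2, h⟩
  · exact absurd (h ▸ hx.1) hcb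
  · exact Or.inl ⟨hx.1, h⟩

theorem card_filter_lt_le_add (E : Finset ℕ) {a b : ℕ} :
    (E.filter (a < ·)).card ≤ (E.filter (b ≤ ·)).card + (b - (a + 1)) := by
  rw [← Nat.card_Ico]
  refine le_trans (card_le_card fun x hx => ?_) (card_union_le _ _)
  rw [mem_filter] at hx
  rw [mem_union, mem_filter, mem_Ico]
  rcases lt_or_ge x b with h | h
  · exact Or.inr ⟨hx.2, h⟩
  · exact Or.inl ⟨hx.1, h⟩

theorem filter_zero_le (E : Finset ℕ) : E.filter (0 ≤ ·) = E := by simp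

theorem excN_insExc {L : ℕ} (hg : 1 ≤ g) (hr : g + L ≤ n) (hσ : FixesFrom n σ) (hp : p ≤ n) :
    excN g (g + L) L (n + 1) (insExc g (g + L) n σ p) = excN g (g + L) L n σ +
      if g + L + excN g (g + L) L n σ ≤ denInc g (g + L) n σ p then 1 else 0 := by
  unfold insExc denInc excN
  split_ifs with h h1 h2 h3 h3
  · exfalso
    have h4 := card_filter_apply_gt_lt hg hσ h
    have h5 := card_filter_add_card_filter_not (s := excPos g (g + L) n σ) (L ≤ ·)
    have h6 : ((excPos g (g + L) n σ).filter (¬ L ≤ ·)).card ≤ L := by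
      conv_rhs => rw [← card_range L]
      refine card_le_card fun x hx => ?_
      rw [mem_filter] at hx
      rw [mem_range]
      omega
    omega
  · rw [excPos_insRaise hg hσ h, add_zero]
  · rw [excPos_insShift_of_le hg hr hσ h2 h]
    have hpE : p ∉ excPos g (g + L) n σ := fun h' => h (mem_excPos.1 h').2
    have hL : L ≤ p := by
      by_contra h'
      have := card_filter_lt_le_add (excPos g (g + L) n σ) (a := p) (b := L)
      omega
    rw [filter_insert, if_pos hL, card_insert_of_notMem fun h' => hpE (mem_filter.1 h').1]
  · rw [excPos_insShift_of_le hg hr hσ h2 h]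
    have hpE : p ∉ excPos g (g + L) n σ := fun h' => h (mem_excPos.1 h').2
    have hL : ¬ L ≤ p := by
      intro h'
      have := card_filter_le_add p h' hpE rfl
      omega
    rw [filter_insert, if_neg hL, add_zero]
  · omega
  · rw [excPos_insShift_of_lt hg hr hσ hp (not_le.1 h2) h, add_zero]

theorem denInc_le (hg : 1 ≤ g) (hσ : FixesFrom n σ) (hp : p ≤ n) : denInc g r n σ p ≤ n := by
  unfold denInc
  split_ifs with h h1
  · have := card_filter_apply_gt_lt hg hσ h
    have := card_excPos_le (r := r) hg hσ
    omega
  · have : ((excPos g r n σ).filter (p < ·)).card ≤ n - g - (p + 1) := by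
      rw [← Nat.card_Ico]
      refine card_le_card fun x hx => ?_
      rw [mem_filter] at hx
      have := isExc_lt hg hσ (mem_excPos.1 hx.1).2
      rw [mem_Ico]
      omega
    omega
  · omega

theorem card_filter_lt_strictAnti {E : Finset ℕ} {f : ℕ → ℕ} {p q : ℕ} (hq : q ∈ E)
    (h : f p < f q) : (E.filter (f q < f ·)).card < (E.filter (f p < f ·)).card := by
  refine card_lt_card ⟨fun x hx => ?_, fun h' => ?_⟩
  · rw [mem_filter] at hx ⊢
    exact ⟨hx.1, h.trans hx.2⟩
  · exact lt_irrefl _ (mem_filter.1 (h' (mem_filter.2 ⟨hq, h⟩))).2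

theorem add_card_filter_lt_strictMono {E : Finset ℕ} {p q : ℕ} (hq : q ∉ E) (h : p < q) :
    p + (E.filter (p < ·)).card < q + (E.filter (q < ·)).card := by
  have := card_filter_le_add (a := p + 1) q h hq rfl
  have h2 : E.filter (p + 1 ≤ ·) = E.filter (p < ·) := rfl
  rw [h2] at this
  omega

theorem denInc_injective (hg : 1 ≤ g) (hσ : FixesFrom n σ) {q : ℕ}
    (hp : p ≤ n) (hq : q ≤ n) (h : denInc g r n σ p = denInc g r n σ q) : p = q := by
  have hE : ∀ p, IsExc g r σ p → p ∈ excPos g r n σ := fun p hX => by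
    have := isExc_lt hg hσ hX
    exact mem_excPos.2 ⟨by omega, hX⟩
  have hlow : ∀ p, ¬ IsExc g r σ p →
      (excPos g r n σ).card ≤ p + ((excPos g r n σ).filter (p < ·)).card := fun p hX => by
    have := card_filter_le_add (a := 0) p (Nat.zero_le _)
      (fun h' : p ∈ excPos g r n σ => hX (mem_excPos.1 h').2) rfl
    rw [filter_zero_le] at this
    omega
  unfold denInc at h
  split_ifs at h with h1 h2 h3 h4 h5 h6 h7 h8
  · apply σ.injective
    rcases lt_trichotomy (σ p) (σ q) with h' | h' | h'
    · have := card_filter_lt_strictAnti (hE q h2) h'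
      omega
    · exact h'
    · have := card_filter_lt_strictAnti (hE p h1) h'
      omega
  · have := card_filter_apply_gt_lt hg hσ h1
    have := hlow q h2
    omega
  · omega
  · have := card_filter_apply_gt_lt hg hσ h5
    have := hlow p h1
    omega
  · rcases lt_trichotomy p q with h' | h' | h'
    · have := add_card_filter_lt_strictMono (fun hm : q ∈ excPos g r n σ =>
        h5 (mem_excPos.1 hm).2) h'
      omega
    · exact h'
    · have := add_card_filter_lt_strictMono (fun hm : p ∈ excPos g r n σ =>
        h1 (mem_excPos.1 hm).2) h'
      omega
  all_goals omega

theorem not_tight_insShift (hg : 1 ≤ g) (hr : r ≤ n) (hσ : FixesFrom n σ) (hp : p ≤ n)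
    (hX : ¬ IsExc g r σ p) (y : ℕ) : ¬ Tight g r n (insShift g r n σ p) y := by
  rintro ⟨hyn, hry, hpy, hy, hmin⟩
  rw [(Equiv.symm_apply_eq _).2 (insShift_self hσ hp hX).symm] at hpy
  have hz : (insShift g r n σ p).symm y = rot (tail (nexcPos g r n σ) n p) (σ.symm y) := by
    rw [Equiv.symm_apply_eq, insShift_rot, Equiv.apply_symm_apply]
  rw [hz] at hy hmin
  set x := σ.symm y with hx
  have hxy : σ x = y := by simp [hx]
  have hxn : x < n := (hσ.symm_lt_iff y).2 hyn
  have hXx : ¬ IsExc g r σ x := fun h' => by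
    have h1 : rot (tail (nexcPos g r n σ) n p) x = x := by
      apply rot_of_notMem
      rw [mem_tail, mem_nexcPos]
      rintro (h | h)
      · omega
      · exact h.1.2 h'
    rw [h1, isExc_insShift_iff hg hr hσ hp hX hxn.le] at hy
    exact hy (Or.inl h')
  have hyx : y < x + g := by
    by_contra h'
    exact hXx ⟨by omega, by omega⟩
  have hpx : p < x := by omega
  have h2 := rot_tail_ge lt_of_mem_nexcPos (mem_nexcPos.2 ⟨hxn, hXx⟩) hpx.le
  have h3 := hmin x h2.1 (by
    rw [isExc_insShift_iff hg hr hσ hp hX hxn.le]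
    rintro (h' | h')
    · exact hXx h'
    · omega)
  omega

theorem exists_mem_lowLetters {v e : ℕ} (he : r ≤ e)
    (hv : v ∈ lowLetters g n σ e) (hev : e ≤ v) :
    ∃ x, σ x = v ∧ IsExc g r σ x ∧ x + g ≤ e := by
  rw [mem_lowLetters] at hv
  refine ⟨σ.symm v, by simp, ?_, hv.2⟩
  rw [IsExc, Equiv.apply_symm_apply]
  omega

theorem tight_insRaise (hg : 1 ≤ g) (hσ : FixesFrom n σ) (hX : IsExc g r σ p) :
    Tight g r n (insRaise g r n σ (σ p)) (σ p) := by
  have hen := isExc_apply_lt hg hσ hX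
  have hq : (insRaise g r n σ (σ p)).symm (σ p) =
      rot (tail (nexcPos g r n σ) n (σ p + 1 - g)) n := by
    rw [Equiv.symm_apply_eq, insRaise_rot_self hg hσ hX]
  have hqn : rot (tail (nexcPos g r n σ) n (σ p + 1 - g)) n ≤ n :=
    rot_tail_self_le lt_of_mem_nexcPos n self_mem_tail
  rw [Tight, hq]
  refine ⟨hen, hX.2, ?_, ?_, ?_⟩
  · set D := tail (lowLetters g n σ (σ p)) n (σ p) with hD
    have hu : (rot D).symm n ∈ D := rot_symm_mem_iff.2 self_mem_tail
    rcases mem_tail.1 hu with h | ⟨h, h'⟩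
    · rw [Equiv.symm_apply_eq, rot_tail_lowLetters_self hg hσ hX] at h
      omega
    · obtain ⟨x, hx1, hx2, hx3⟩ := exists_mem_lowLetters hX.2 h h'
      have : insRaise g r n σ (σ p) x = n := by
        rw [insRaise_of_isExc hg hσ hx2, hx1, ← hD, Equiv.apply_symm_apply]
      rwa [(Equiv.symm_apply_eq _).2 this.symm]
  · rintro ⟨h1, -⟩
    rw [insRaise_rot_self hg hσ hX] at h1
    have := lt_rot_tail_nexcPos_self (r := r) (σ := σ) hen hg
    omega
  · intro x hx hXx
    rw [isExc_insRaise_iff hg hσ hX (by omega)] at hXx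
    by_contra h'
    have := rot_tail_self_le (N := nexcPos g r n σ) (n := n) (k := σ p + 1 - g) lt_of_mem_nexcPos x
      (mem_tail.2 (Or.inr ⟨mem_nexcPos.2 ⟨by omega, hXx⟩, by omega⟩))
    omega

theorem le_of_tight_insRaise (hg : 1 ≤ g) (hσ : FixesFrom n σ) (hX : IsExc g r σ p) {y : ℕ}
    (hy : Tight g r n (insRaise g r n σ (σ p)) y) : y ≤ σ p := by
  obtain ⟨hyn, hry, -, hXy, hmin⟩ := hy
  by_contra hlt
  have hz : (insRaise g r n σ (σ p)).symm y < n + 1 :=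
    ((insRaise_fixesFrom hσ).symm_lt_iff y).2 (by omega)
  have hmem : (insRaise g r n σ (σ p)).symm y ∈ insert n (nexcPos g r n σ) := by
    rw [isExc_insRaise_iff hg hσ hX (by omega)] at hXy
    rw [mem_insert, mem_nexcPos]
    rcases (Nat.lt_succ_iff.1 hz).lt_or_eq with h' | h'
    · exact Or.inr ⟨h', hXy⟩
    · exact Or.inl h'
  rw [← insert_image_rot_tail (k := σ p + 1 - g), mem_insert, mem_image] at hmem
  rcases hmem with h | ⟨x, hx, hxz⟩
  · rw [Equiv.symm_apply_eq, insRaise_rot_self hg hσ hX] at h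
    omega
  · have hxy : σ x = y := by
      rw [← insRaise_rot_of_mem hσ hX.2 hx, hxz, Equiv.apply_symm_apply]
    obtain ⟨hxn, hXx⟩ := mem_nexcPos.1 hx
    have hyx : y < x + g := by
      by_contra h'
      exact hXx ⟨by omega, by omega⟩
    have h2 := rot_tail_ge (k := σ p + 1 - g) lt_of_mem_nexcPos hx (by omega)
    have h3 := hmin x (by omega) (by rwa [isExc_insRaise_iff hg hσ hX hxn.le])
    omega

theorem tail_nexcPos_insShift (hg : 1 ≤ g) (hr : r ≤ n) (hσ : FixesFrom n σ) (hp : p ≤ n)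
    (hX : ¬ IsExc g r σ p) :
    tail (nexcPos g r n σ) n p = (range (n + 1)).filter fun y =>
      y = p ∨ (¬ IsExc g r (insShift g r n σ p) y ∧ p < y) := by
  ext y
  rw [mem_tail, mem_nexcPos, mem_filter, mem_range]
  by_cases hy : y ≤ n
  · rw [isExc_insShift_iff hg hr hσ hp hX hy]
    by_cases hyp : y = p
    · subst hyp
      simp only [hX, not_false_eq_true, true_or, and_true, le_refl]
      omega
    · rcases hy.lt_or_eq with h | rfl
      · have : p < y ↔ p ≤ y := by omega
        simp only [this, hyp, false_and, or_false, false_or, h.ne, h, true_and,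
          Nat.lt_succ_of_lt h]
      · have := not_isExc_self (r := r) hg hσ le_rfl
        simp only [this, hyp, false_and, or_false, false_or, not_false_eq_true, true_and, true_or,
          true_iff]
        omega
  · constructor
    · rintro (h | h) <;> omega
    · rintro ⟨h, -⟩
      omega

theorem tail_nexcPos_insRaise (hg : 1 ≤ g) (hσ : FixesFrom n σ) (hX : IsExc g r σ p) :
    tail (nexcPos g r n σ) n (σ p + 1 - g) = (range (n + 1)).filter fun y =>
      ¬ IsExc g r (insRaise g r n σ (σ p)) y ∧ σ p + 1 - g ≤ y := by
  have hen := isExc_apply_lt hg hσ hX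
  ext y
  rw [mem_tail, mem_nexcPos, mem_filter, mem_range]
  by_cases hy : y ≤ n
  · rw [isExc_insRaise_iff hg hσ hX hy]
    rcases hy.lt_or_eq with h | rfl
    · simp only [h.ne, h, Nat.lt_succ_of_lt h, true_and, false_or]
    · have := not_isExc_self (r := r) hg hσ le_rfl
      simp only [this, true_or, true_iff, not_false_eq_true, true_and]
      omega
  · constructor
    · rintro (h | h) <;> omega
    · rintro ⟨h, -⟩
      omega

theorem tail_lowLetters_insRaise (hg : 1 ≤ g) (hσ : FixesFrom n σ) (hX : IsExc g r σ p) :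
    tail (lowLetters g n σ (σ p)) n (σ p) = (range (n + 1)).filter fun v =>
      v = σ p ∨ (σ p ≤ v ∧ (insRaise g r n σ (σ p)).symm v + g ≤ σ p) := by
  have hen := isExc_apply_lt hg hσ hX
  set D := tail (lowLetters g n σ (σ p)) n (σ p) with hD
  ext v
  rw [mem_filter, mem_range]
  constructor
  · intro hv
    have hv' := mem_tail.1 hv
    have hvn : v < n + 1 ∧ σ p ≤ v := by
      rcases hv' with h | h
      · omega
      · have := lt_of_mem_lowLetters v h.1
        omega
    refine ⟨hvn.1, ?_⟩
    rcases mem_tail.1 (rot_symm_mem_iff.2 hv) with h | ⟨h, h'⟩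
    · rw [Equiv.symm_apply_eq, rot_tail_lowLetters_self hg hσ hX] at h
      exact Or.inl h
    · obtain ⟨x, hx1, hx2, hx3⟩ := exists_mem_lowLetters hX.2 h h'
      have : insRaise g r n σ (σ p) x = v := by
        rw [insRaise_of_isExc hg hσ hx2, hx1, ← hD, Equiv.apply_symm_apply]
      rw [(Equiv.symm_apply_eq _).2 this.symm]
      exact Or.inr ⟨hvn.2, hx3⟩
  · rintro ⟨hvn, rfl | ⟨hv1, hv2⟩⟩
    · rw [← rot_tail_lowLetters_self hg hσ hX]
      exact rot_mem self_mem_tail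
    · set x := (insRaise g r n σ (σ p)).symm v with hx
      have hxv : insRaise g r n σ (σ p) x = v := by simp [hx]
      have hre := hX.2
      have hXx : IsExc g r σ x := by
        rw [← isExc_insRaise_iff hg hσ hX (by omega), IsExc, hxv]
        omega
      rw [insRaise_of_isExc hg hσ hXx, ← hD] at hxv
      by_cases h : σ x ∈ D
      · rw [← hxv]
        exact rot_mem h
      · rw [rot_of_notMem h] at hxv
        rw [← hxv, hD, mem_tail, mem_lowLetters, Equiv.symm_apply_apply]
        exact Or.inr ⟨⟨isExc_apply_lt hg hσ hXx, hv2⟩, hxv ▸ hv1⟩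

theorem insExc_injective (hg : 1 ≤ g) (hr : r ≤ n) (hσ : FixesFrom n σ) (hp : p ≤ n)
    {σ' : Equiv.Perm ℕ} {q : ℕ} (hσ' : FixesFrom n σ') (hq : q ≤ n)
    (h : insExc g r n σ p = insExc g r n σ' q) : σ = σ' ∧ p = q := by
  unfold insExc at h
  split_ifs at h with h1 h2 h2
  · have ht := tight_insRaise hg hσ h1
    have ht' := tight_insRaise hg hσ' h2
    rw [h] at ht
    rw [← h] at ht'
    have he : σ p = σ' q := le_antisymm (le_of_tight_insRaise hg hσ' h2 ht)
      (le_of_tight_insRaise hg hσ h1 ht')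
    have hN := tail_nexcPos_insRaise hg hσ h1
    have hN' := tail_nexcPos_insRaise hg hσ' h2
    have hD := tail_lowLetters_insRaise hg hσ h1
    have hD' := tail_lowLetters_insRaise hg hσ' h2
    rw [h, he, ← hN'] at hN
    rw [h, he, ← hD'] at hD
    have hσσ : σ = σ' := by
      ext x
      have h3 := insRaise_rot g r n σ (σ p) x
      rw [h, he, hN, hD, insRaise_rot] at h3
      rw [(rot _).injective h3]
    subst hσσ
    exact ⟨rfl, σ.injective he⟩
  · have := tight_insRaise hg hσ h1
    rw [h] at this
    exact absurd this (not_tight_insShift hg hr hσ' hq h2 _)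
  · have := tight_insRaise hg hσ' h2
    rw [← h] at this
    exact absurd this (not_tight_insShift hg hr hσ hp h1 _)
  · have hpq : p = q := by
      apply (insShift g r n σ p).injective
      rw [insShift_self hσ hp h1, h, insShift_self hσ' hq h2]
    subst hpq
    have hN := tail_nexcPos_insShift hg hr hσ hp h1
    rw [h, ← tail_nexcPos_insShift hg hr hσ' hp h2] at hN
    refine ⟨?_, rfl⟩
    ext x
    rw [← insShift_rot g r n σ p x, h, hN, insShift_rot]

end Insertion

/-- The `r`-descents of the word `σ 0, …, σ (n - 1)`, counted from `0`. -/
def desPos (r n : ℕ) (σ : ℕ → ℕ) : Finset ℕ :=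
  (range n).filter fun i => i + 1 < n ∧ σ (i + 1) + r ≤ σ i

/-- The number of inversions of the word `σ` at positions in `A` whose letters differ by less
than `r`. -/
def smallInv (r : ℕ) (σ : ℕ → ℕ) (A : Finset ℕ) : ℕ :=
  ((A ×ˢ A).filter fun p => p.1 < p.2 ∧ σ p.2 < σ p.1 ∧ σ p.1 < σ p.2 + r).card

/-- The `r`-major index of the word `σ 0, …, σ (n - 1)`. -/
def rmajN (r n : ℕ) (σ : ℕ → ℕ) : ℕ := ∑ i ∈ desPos r n σ, (i + 1) + smallInv r σ (range n)

theorem mem_desPos {r n i : ℕ} {σ : ℕ → ℕ} :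
    i ∈ desPos r n σ ↔ i + 1 < n ∧ σ (i + 1) + r ≤ σ i := by
  simp only [desPos, mem_filter, mem_range, and_iff_right_iff_imp]
  omega

theorem smallInv_eq_sum (r : ℕ) (σ : ℕ → ℕ) (A : Finset ℕ) :
    smallInv r σ A =
      ∑ i ∈ A, ∑ j ∈ A, if i < j ∧ σ j < σ i ∧ σ i < σ j + r then 1 else 0 := by
  rw [smallInv, card_filter, sum_product]

/-- Insert the letter `n` at position `p`, shifting all later letters. -/
def insWord (n : ℕ) (σ : Equiv.Perm ℕ) (p : ℕ) : Equiv.Perm ℕ :=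
  σ * (rot (tail (range n) n p)).symm

/-- The positions below `n` at which inserting `n` does not create a further `r`-descent. -/
def keepPos (r n : ℕ) (σ : ℕ → ℕ) : Finset ℕ :=
  ((range n).filter fun q => n < σ q + r) ∪ (desPos r n σ).image (· + 1)

/-- The amount by which `insWord` increases the `r`-major index. -/
def majInc (r n : ℕ) (σ : ℕ → ℕ) (p : ℕ) : ℕ :=
  if p ∈ insert n (keepPos r n σ) then ((keepPos r n σ).filter (p ≤ ·)).card
  else p + 1 + ((keepPos r n σ).filter (p ≤ ·)).card

section Word

variable {r n p : ℕ} {σ : Equiv.Perm ℕ}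

theorem insWord_rot (n : ℕ) (σ : Equiv.Perm ℕ) (p x : ℕ) :
    insWord n σ p (rot (tail (range n) n p) x) = σ x := by
  simp [insWord]

theorem lt_of_mem_range : ∀ x ∈ range n, x < n := fun _ => mem_range.1

theorem rot_tail_range_lt {x : ℕ} (hp : p ≤ n) (hx : x < p) :
    rot (tail (range n) n p) x = x :=
  rot_tail_lt lt_of_mem_range (mem_range.2 (by omega)) hx

theorem rot_tail_range_ge {x : ℕ} (hx : p ≤ x) (hxn : x < n) :
    rot (tail (range n) n p) x = x + 1 := by
  have h1 : x ∈ tail (range n) n p := mem_tail.2 (Or.inr ⟨mem_range.2 hxn, hx⟩)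
  have h2 : x + 1 ∈ tail (range n) n p := by
    rw [mem_tail, mem_range]
    omega
  have := rot_between h1 h2 (Nat.lt_succ_self x)
  omega

theorem rot_tail_range_self (hp : p ≤ n) : rot (tail (range n) n p) n = p := by
  have h1 : p ∈ tail (range n) n p := by
    rw [mem_tail, mem_range]
    omega
  have h2 := rot_tail_self_le lt_of_mem_range p h1
  have h3 := mem_tail.1 (rot_mem (self_mem_tail (N := range n) (n := n) (k := p)))
  omega

theorem insWord_lt {x : ℕ} (hp : p ≤ n) (hx : x < p) : insWord n σ p x = σ x := by
  rw [← insWord_rot n σ p x, rot_tail_range_lt hp hx]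

theorem insWord_succ {x : ℕ} (hx : p ≤ x) (hxn : x < n) : insWord n σ p (x + 1) = σ x := by
  rw [← insWord_rot n σ p x, rot_tail_range_ge hx hxn]

theorem insWord_self (hσ : FixesFrom n σ) (hp : p ≤ n) : insWord n σ p p = n := by
  have := insWord_rot n σ p n
  rwa [rot_tail_range_self hp, hσ n le_rfl] at this

theorem insWord_fixesFrom (hσ : FixesFrom n σ) :
    FixesFrom (n + 1) (insWord n σ p) :=
  hσ.succ.mul (fixesFrom_rot_tail lt_of_mem_range).symm

theorem insWord_injective (hσ : FixesFrom n σ) (hp : p ≤ n) {τ : Equiv.Perm ℕ} {q : ℕ}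
    (hτ : FixesFrom n τ) (hq : q ≤ n) (h : insWord n σ p = insWord n τ q) : σ = τ ∧ p = q := by
  have hpq : p = q := by
    apply (insWord n σ p).injective
    rw [insWord_self hσ hp, h, insWord_self hτ hq]
  subst hpq
  exact ⟨mul_right_cancel h, rfl⟩

theorem smallInv_insWord (hσ : FixesFrom n σ) (hp : p ≤ n) :
    smallInv r (insWord n σ p) (range (n + 1)) = smallInv r σ (range n) +
      ((range n).filter fun q => p ≤ q ∧ n < σ q + r).card := by
  have hf := strictMonoOn_rot_tail (N := range n) (n := n) (k := p) lt_of_mem_range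
  have h0 := rot_tail_self_notMem_image (N := range n) (n := n) (k := p) lt_of_mem_range
  have h1 : range (n + 1) = insert (rot (tail (range n) n p) n)
      ((range n).image (rot (tail (range n) n p))) := by
    rw [insert_image_rot_tail, range_add_one]
  rw [smallInv_eq_sum, smallInv_eq_sum, h1, sum_insert h0, sum_insert h0, sum_image hf.injOn,
    sum_image hf.injOn]
  simp only [sum_insert h0, sum_image hf.injOn, insWord_rot, lt_irrefl, false_and, if_false,
    zero_add, sum_add_distrib]
  rw [card_filter]
  have h2 : ∑ x ∈ range n, (if rot (tail (range n) n p) x < rot (tail (range n) n p) n ∧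
      σ n < σ x ∧ σ x < σ n + r then 1 else 0) = 0 := by
    refine sum_eq_zero fun x hx => if_neg ?_
    rw [hσ n le_rfl]
    have := (hσ.lt_iff x).2 (mem_range.1 hx)
    omega
  have h3 : ∑ x ∈ range n, (if rot (tail (range n) n p) n < rot (tail (range n) n p) x ∧
      σ x < σ n ∧ σ n < σ x + r then 1 else 0) =
      ∑ x ∈ range n, if p ≤ x ∧ n < σ x + r then 1 else 0 := by
    refine sum_congr rfl fun x hx => ?_
    have := (hσ.lt_iff x).2 (mem_range.1 hx)
    simp only [hσ n le_rfl, rot_tail_self_lt_iff lt_of_mem_range hp hx, this, true_and]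
  have h4 : ∑ x ∈ range n, ∑ y ∈ range n, (if rot (tail (range n) n p) x <
      rot (tail (range n) n p) y ∧ σ y < σ x ∧ σ x < σ y + r then 1 else 0) =
      ∑ x ∈ range n, ∑ y ∈ range n, if x < y ∧ σ y < σ x ∧ σ x < σ y + r then 1 else 0 := by
    refine sum_congr rfl fun x hx => sum_congr rfl fun y hy => ?_
    simp only [hf.lt_iff_lt hx hy]
  rw [h2, h3, h4]
  ring

theorem mem_desPos_insWord (hr : 1 ≤ r) (hσ : FixesFrom n σ) (hp : p ≤ n) {y : ℕ} :
    y ∈ desPos r (n + 1) (insWord n σ p) ↔ (y = p ∧ p < n ∧ σ p + r ≤ n) ∨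
      y ∈ ((desPos r n σ).filter (· + 1 ≠ p)).image (rot (tail (range n) n p)) := by
  have himg : y ∈ ((desPos r n σ).filter (· + 1 ≠ p)).image (rot (tail (range n) n p)) ↔
      (y + 1 < p ∧ y ∈ desPos r n σ) ∨ (p < y ∧ y - 1 ∈ desPos r n σ) := by
    simp only [mem_image, mem_filter]
    constructor
    · rintro ⟨x, ⟨hx, hxp⟩, rfl⟩
      have hxn := (mem_desPos.1 hx).1
      rcases lt_or_ge x p with h | h
      · rw [rot_tail_range_lt hp h]
        exact Or.inl ⟨by omega, hx⟩
      · rw [rot_tail_range_ge h (by omega)]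
        exact Or.inr ⟨by omega, by simpa using hx⟩
    · rintro (⟨h, hy⟩ | ⟨h, hy⟩)
      · exact ⟨y, ⟨hy, by omega⟩, rot_tail_range_lt hp (by omega)⟩
      · have := (mem_desPos.1 hy).1
        refine ⟨y - 1, ⟨hy, by omega⟩, ?_⟩
        rw [rot_tail_range_ge (by omega) (by omega)]
        omega
  rw [himg, mem_desPos, mem_desPos, mem_desPos]
  rcases lt_trichotomy y p with h | rfl | h
  · rcases (show y + 1 < p ∨ y + 1 = p by omega) with h' | h1
    · rw [insWord_lt hp h', insWord_lt hp h]
      omega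
    · have h2 := (hσ.lt_iff y).2 (by omega)
      rw [h1, insWord_self hσ hp, insWord_lt hp h]
      omega
  · rw [insWord_self hσ hp]
    by_cases h : y < n
    · rw [insWord_succ le_rfl h]
      omega
    · omega
  · by_cases h' : y < n
    · obtain ⟨x, rfl⟩ : ∃ x, y = x + 1 := ⟨y - 1, by omega⟩
      rw [insWord_succ (by omega) h', insWord_succ (by omega) (by omega), Nat.add_sub_cancel]
      omega
    · omega

theorem sum_desPos_insWord (hr : 1 ≤ r) (hσ : FixesFrom n σ) (hp : p ≤ n) (w : ℕ → ℕ) :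
    ∑ y ∈ desPos r (n + 1) (insWord n σ p), w y = (if p < n ∧ σ p + r ≤ n then w p else 0) +
      ∑ x ∈ (desPos r n σ).filter (· + 1 ≠ p), w (if p ≤ x then x + 1 else x) := by
  have h1 : ∑ x ∈ (desPos r n σ).filter (· + 1 ≠ p), w (if p ≤ x then x + 1 else x) =
      ∑ y ∈ ((desPos r n σ).filter (· + 1 ≠ p)).image (rot (tail (range n) n p)), w y := by
    rw [sum_image (Equiv.injective _).injOn]
    refine sum_congr rfl fun x hx => ?_
    have := (mem_desPos.1 (mem_filter.1 hx).1).1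
    split_ifs with h
    · rw [rot_tail_range_ge h (by omega)]
    · rw [rot_tail_range_lt hp (not_le.1 h)]
  have h2 : p ∉ ((desPos r n σ).filter (· + 1 ≠ p)).image (rot (tail (range n) n p)) := by
    rw [mem_image]
    rintro ⟨x, hx, hxp⟩
    have := (mem_desPos.1 (mem_filter.1 hx).1).1
    rcases lt_or_ge x p with h | h
    · rw [rot_tail_range_lt hp h] at hxp
      omega
    · rw [rot_tail_range_ge h (by omega)] at hxp
      omega
  rw [h1]
  split_ifs with h
  · rw [← sum_insert h2]
    refine sum_congr ?_ fun _ _ => rfl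
    ext y
    rw [mem_desPos_insWord hr hσ hp, mem_insert]
    simp only [h, and_true]
  · rw [zero_add]
    refine sum_congr ?_ fun _ _ => rfl
    ext y
    rw [mem_desPos_insWord hr hσ hp]
    simp only [h, and_false, false_or]

theorem card_keepPos_filter (hσ : FixesFrom n σ) :
    ((keepPos r n σ).filter (p ≤ ·)).card =
      ((range n).filter fun q => p ≤ q ∧ n < σ q + r).card +
        ((desPos r n σ).filter (p ≤ · + 1)).card := by
  have hd : Disjoint (((range n).filter fun q => n < σ q + r).filter (p ≤ ·))
      (((desPos r n σ).image (· + 1)).filter (p ≤ ·)) := by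
    refine disjoint_left.2 fun q hq hq' => ?_
    simp only [mem_filter, mem_image, mem_desPos] at hq hq'
    obtain ⟨⟨i, hi, rfl⟩, -⟩ := hq'
    have := (hσ.lt_iff i).2 (by omega)
    omega
  rw [keepPos, filter_union, card_union_of_disjoint hd, filter_filter, filter_image,
    card_image_of_injective _ (add_left_injective 1)]
  simp only [and_comm]

theorem card_keepPos (hr : 1 ≤ r) (hrn : r ≤ n) (hσ : FixesFrom n σ) :
    (keepPos r n σ).card + 1 = r + (desPos r n σ).card := by
  have h := card_keepPos_filter (r := r) (p := 0) hσ
  simp only [Nat.zero_le, true_and, filter_true] at h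
  have h2 : ((range n).filter fun q => n < σ q + r).image σ = Ioo (n - r) n := by
    ext v
    simp only [mem_image, mem_filter, mem_range, mem_Ioo]
    constructor
    · rintro ⟨q, hq, rfl⟩
      have := (hσ.lt_iff q).2 hq.1
      omega
    · intro hv
      refine ⟨σ.symm v, ⟨(hσ.symm_lt_iff v).2 hv.2, ?_⟩, by simp⟩
      rw [Equiv.apply_symm_apply]
      omega
  have h3 := congrArg card h2
  rw [card_image_of_injective _ σ.injective, Nat.card_Ioo] at h3
  omega

theorem lt_of_mem_keepPos {q : ℕ} (hq : q ∈ keepPos r n σ) : q < n := by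
  simp only [keepPos, mem_union, mem_filter, mem_range, mem_image, mem_desPos] at hq
  rcases hq with h | ⟨i, h, rfl⟩
  · exact h.1
  · exact h.1

theorem rmajN_insWord_and_card (hr : 1 ≤ r) (hσ : FixesFrom n σ) (hp : p ≤ n) :
    rmajN r (n + 1) (insWord n σ p) = rmajN r n σ + majInc r n σ p ∧
      (desPos r (n + 1) (insWord n σ p)).card =
        (desPos r n σ).card + if p ∈ insert n (keepPos r n σ) then 0 else 1 := by
  have hs := sum_desPos_insWord hr hσ hp (· + 1)
  have hc := sum_desPos_insWord hr hσ hp fun _ => 1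
  have hw : ∀ x, (if p ≤ x then x + 1 else x) + 1 = x + 1 + if p ≤ x then 1 else 0 := fun x => by
    split_ifs <;> rfl
  simp only [hw, sum_add_distrib (f := fun x => x + 1), sum_boole, Nat.cast_id] at hs
  simp only [sum_const, smul_eq_mul, mul_one] at hc
  have hmem : p ∈ insert n (keepPos r n σ) ↔
      p = n ∨ (p < n ∧ n < σ p + r) ∨ ∃ i ∈ desPos r n σ, i + 1 = p := by
    simp only [keepPos, mem_insert, mem_union, mem_filter, mem_range, mem_image]
  rw [majInc, rmajN, rmajN, hs, hc, smallInv_insWord hσ hp,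
    card_keepPos_filter hσ]
  by_cases hD : ∃ i ∈ desPos r n σ, i + 1 = p
  · obtain ⟨i, hi, rfl⟩ := hD
    have hi' := mem_desPos.1 hi
    have hin := (hσ.lt_iff i).2 (by omega)
    have h1 : (desPos r n σ).filter (· + 1 ≠ i + 1) = (desPos r n σ).erase i := by
      ext x
      simp only [mem_filter, mem_erase, ne_eq, Nat.add_right_cancel_iff, and_comm]
    have h2 : (desPos r n σ).filter (i + 1 ≤ · + 1) =
        insert i (((desPos r n σ).erase i).filter (i + 1 ≤ ·)) := by
      ext x
      simp only [mem_filter, mem_insert, mem_erase]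
      by_cases hx : x = i
      · subst hx
        simp [hi]
      · simp only [hx, false_or, ne_eq, not_false_eq_true, true_and]
        constructor
        · rintro ⟨h, h'⟩
          exact ⟨h, by omega⟩
        · rintro ⟨h, h'⟩
          exact ⟨h, by omega⟩
    have h3 : i ∉ ((desPos r n σ).erase i).filter (i + 1 ≤ ·) := by simp
    have h4 : i + 1 < n ∧ σ (i + 1) + r ≤ n := by omega
    rw [if_pos h4, if_pos h4, if_pos (hmem.2 (Or.inr (Or.inr ⟨i, hi, rfl⟩))),
      if_pos (hmem.2 (Or.inr (Or.inr ⟨i, hi, rfl⟩))), h1, h2,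
      card_insert_of_notMem h3, ← add_sum_erase _ _ hi, card_erase_of_mem hi]
    have := card_pos.2 ⟨i, hi⟩
    omega
  · have h1 : (desPos r n σ).filter (· + 1 ≠ p) = desPos r n σ :=
      filter_true_of_mem fun x hx h => hD ⟨x, hx, h⟩
    have h2 : (desPos r n σ).filter (p ≤ · + 1) = (desPos r n σ).filter (p ≤ ·) :=
      filter_congr fun x hx => by
        have : x + 1 ≠ p := fun h => hD ⟨x, hx, h⟩
        omega
    rw [h1, h2]
    simp only [hD, or_false] at hmem
    by_cases h : p < n ∧ σ p + r ≤ n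
    · rw [if_pos h, if_pos h, if_neg fun h' => by have := hmem.1 h'; omega,
        if_neg fun h' => by have := hmem.1 h'; omega]
      omega
    · rw [if_neg h, if_neg h, if_pos (hmem.2 (by omega)), if_pos (hmem.2 (by omega))]
      omega

theorem card_keepPos_le_of_notMem (h : p ∉ keepPos r n σ) :
    (keepPos r n σ).card ≤ p + ((keepPos r n σ).filter (p ≤ ·)).card := by
  have := card_filter_le_add (a := 0) p (Nat.zero_le _) h rfl
  have h2 : ((keepPos r n σ).filter (p < ·)).card ≤ ((keepPos r n σ).filter (p ≤ ·)).card :=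
    card_le_card (monotone_filter_right _ fun _ _ => le_of_lt)
  rw [filter_zero_le] at this
  omega

theorem card_desPos_insWord (hr : 1 ≤ r) (hrn : r ≤ n) (hσ : FixesFrom n σ) (hp : p ≤ n) :
    (desPos r (n + 1) (insWord n σ p)).card = (desPos r n σ).card +
      if r + (desPos r n σ).card ≤ majInc r n σ p then 1 else 0 := by
  rw [(rmajN_insWord_and_card hr hσ hp).2, ← card_keepPos hr hrn hσ, majInc]
  by_cases h : p ∈ insert n (keepPos r n σ)
  · have := card_filter_le (keepPos r n σ) (p ≤ ·)
    rw [if_pos h, if_pos h, if_neg (by omega)]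
  · have := card_keepPos_le_of_notMem fun h' => h (mem_insert_of_mem h')
    rw [if_neg h, if_neg h, if_pos (by omega)]

theorem majInc_le (hp : p ≤ n) : majInc r n σ p ≤ n := by
  rw [majInc]
  split_ifs with h
  · refine (card_filter_le _ _).trans (le_trans (card_le_card ?_) (card_range n).le)
    exact fun x hx => mem_range.2 (lt_of_mem_keepPos hx)
  · have : ((keepPos r n σ).filter (p ≤ ·)).card ≤ n - (p + 1) := by
      rw [← Nat.card_Ico]
      refine card_le_card fun x hx => ?_
      rw [mem_filter] at hx
      have h1 : x ≠ p := fun h' => h (mem_insert_of_mem (h' ▸ hx.1))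
      have := lt_of_mem_keepPos hx.1
      rw [mem_Ico]
      omega
    have h2 : p ≠ n := fun h' => h (by rw [h']; exact mem_insert_self _ _)
    omega

theorem majInc_injective {q : ℕ} (hp : p ≤ n) (hq : q ≤ n)
    (h : majInc r n σ p = majInc r n σ q) : p = q := by
  have hlow : ∀ p, p ∉ insert n (keepPos r n σ) → (keepPos r n σ).card ≤
      p + ((keepPos r n σ).filter (p ≤ ·)).card :=
    fun p h => card_keepPos_le_of_notMem fun h' => h (mem_insert_of_mem h')
  have hanti : ∀ p q, p ∈ insert n (keepPos r n σ) → p < q → q ≤ n →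
      ((keepPos r n σ).filter (q ≤ ·)).card < ((keepPos r n σ).filter (p ≤ ·)).card := by
    intro p q hp hpq hq
    have hpT : p ∈ keepPos r n σ := (mem_insert.1 hp).resolve_left (by omega)
    refine card_lt_card ⟨fun x hx => ?_, fun h' => ?_⟩
    · rw [mem_filter] at hx ⊢
      exact ⟨hx.1, hpq.le.trans hx.2⟩
    · exact absurd (mem_filter.1 (h' (mem_filter.2 ⟨hpT, le_rfl⟩))).2 (not_le.2 hpq)
  have hmono : ∀ p q, p ∉ insert n (keepPos r n σ) → p < q →
      p + ((keepPos r n σ).filter (p ≤ ·)).card < q + ((keepPos r n σ).filter (q ≤ ·)).card := by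
    intro p q hp hpq
    have h1 : (keepPos r n σ).filter (p ≤ ·) = (keepPos r n σ).filter (p < ·) :=
      filter_congr fun x hx => by
        have : x ≠ p := fun h' => hp (mem_insert_of_mem (h' ▸ hx))
        omega
    have := card_filter_lt_le_add (keepPos r n σ) (a := p) (b := q)
    rw [h1]
    omega
  unfold majInc at h
  have hcp := card_filter_le (keepPos r n σ) (p ≤ ·)
  have hcq := card_filter_le (keepPos r n σ) (q ≤ ·)
  split_ifs at h with h1 h2 h2
  · rcases lt_trichotomy p q with h' | h' | h'
    · have := hanti p q h1 h' hq
      omega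
    · exact h'
    · have := hanti q p h2 h' hp
      omega
  · have := hlow q h2
    omega
  · have := hlow p h1
    omega
  · rcases lt_trichotomy p q with h' | h' | h'
    · have := hmono p q h1 h'
      omega
    · exact h'
    · have := hmono q p h2 h'
      omega

end Word

section Translation

variable {n : ℕ}

theorem sum_filter_fin (P : ℕ → Prop) [DecidablePred P] (f : ℕ → ℕ) :
    ∑ i ∈ univ.filter (fun i : Fin n => P i), f i = ∑ i ∈ range n with P i, f i := by
  rw [sum_filter, sum_filter, ← Fin.sum_univ_eq_sum_range fun i => if P i then f i else 0]

theorem sum_filter_fin_prod (P : ℕ → ℕ → Prop) [∀ i j, Decidable (P i j)] (f : ℕ → ℕ) :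
    ∑ p : Fin n × Fin n with P p.1 p.2, f p.1 =
      ∑ p ∈ range n ×ˢ range n with P p.1 p.2, f p.1 := by
  rw [sum_filter, sum_filter, sum_product, Fintype.sum_prod_type,
    ← Fin.sum_univ_eq_sum_range fun i => ∑ j ∈ range n, if P i j then f i else 0]
  refine sum_congr rfl fun i _ => ?_
  rw [← Fin.sum_univ_eq_sum_range fun j => if P i j then f i else 0]

theorem card_filter_fin_prod (P : ℕ → ℕ → Prop) [∀ i j, Decidable (P i j)] :
    (univ.filter fun p : Fin n × Fin n => P p.1 p.2).card =
      ((range n ×ˢ range n).filter fun p => P p.1 p.2).card := by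
  simpa only [card_eq_sum_ones] using sum_filter_fin_prod P fun _ => 1

theorem gexc_eq_excN (g L : ℕ) (σ : Equiv.Perm (Fin n)) :
    gexc g (L + 1) σ = excN g (g + L) L n (extNat σ) := by
  have h := sum_filter_fin (n := n) (fun i => i + 1 + g ≤ extNat σ i + 1 ∧ L + 1 ≤ i + 1) fun _ => 1
  simp only [extNat_coe, ← card_eq_sum_ones] at h
  rw [gexc, excN, excPos, filter_filter]
  refine h.trans (congrArg card (filter_congr fun i _ => ?_))
  rw [IsExc]
  omega

theorem invOn_eq_invN (σ : Equiv.Perm (Fin n)) (P : Fin n → Prop) [DecidablePred P] (Q : ℕ → Prop)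
    [DecidablePred Q] (hPQ : ∀ i, P i ↔ Q i) :
    invOn σ P = invN (extNat σ) ((range n).filter Q) := by
  have h := card_filter_fin_prod (n := n) fun i j =>
    i < j ∧ Q i ∧ Q j ∧ extNat σ j + 1 < extNat σ i + 1
  simp only [extNat_coe] at h
  rw [invOn, invN]
  simp only [hPQ]
  refine h.trans (congrArg card ?_)
  ext p
  simp only [mem_filter, mem_product]
  rw [Nat.add_lt_add_iff_right]
  tauto

theorem gden_eq_denN (g L : ℕ) (σ : Equiv.Perm (Fin n)) :
    gden g (g + (L + 1)) σ = denN g (g + L) n (extNat σ) := by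
  have hX : ∀ i : Fin n, pos1 i + g ≤ val1 σ i ∧ g + (L + 1) ≤ val1 σ i ↔
      IsExc g (g + L) (extNat σ) i := fun i => by
    rw [IsExc, extNat_coe, pos1, val1]
    omega
  rw [gden, denN, invOn_eq_invN σ _ _ hX,
    invOn_eq_invN σ _ (fun i => ¬ IsExc g (g + L) (extNat σ) i)
    fun i => not_congr (hX i)]
  have h := sum_filter_fin (n := n) (IsExc g (g + L) (extNat σ)) fun i => i + g
  rw [excPos, nexcPos, ← h]
  simp only [hX]
  refine congrArg (· + _ + _) (sum_congr rfl fun i _ => ?_)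
  rw [pos1]
  omega

theorem sum_rdesPairs (r : ℕ) (σ : Equiv.Perm (Fin n)) (f : ℕ → ℕ) :
    ∑ p ∈ rdesPairs r σ, f p.1 = ∑ i ∈ desPos r n (extNat σ), f i := by
  have h := sum_filter_fin_prod (n := n) (fun i j =>
    j + 1 = i + 1 + 1 ∧ extNat σ j + 1 + r ≤ extNat σ i + 1) f
  simp only [extNat_coe] at h
  refine h.trans ?_
  rw [sum_filter, sum_product, desPos, sum_filter]
  refine sum_congr rfl fun i _ => ?_
  have h2 : ∀ j, (j + 1 = i + 1 + 1 ∧ extNat σ j + 1 + r ≤ extNat σ i + 1) ↔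
      (i + 1 = j ∧ extNat σ (i + 1) + r ≤ extNat σ i) := fun j => by
    constructor
    · rintro ⟨h, h'⟩
      obtain rfl : j = i + 1 := by omega
      omega
    · rintro ⟨rfl, h'⟩
      omega
  simp only [h2, ite_and, sum_ite_eq, mem_range]

theorem rdes_eq_card (r : ℕ) (σ : Equiv.Perm (Fin n)) :
    rdes r σ = (desPos r n (extNat σ)).card := by
  simpa only [rdes, card_eq_sum_ones] using sum_rdesPairs r σ fun _ => 1

theorem rmaj_eq_rmajN (r : ℕ) (σ : Equiv.Perm (Fin n)) :
    rmaj r σ = rmajN r n (extNat σ) := by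
  have h := card_filter_fin_prod (n := n) fun i j => i < j ∧
    extNat σ j + 1 < extNat σ i + 1 ∧ extNat σ i + 1 < extNat σ j + 1 + r
  simp only [extNat_coe] at h
  rw [rmajN, ← sum_rdesPairs r σ (· + 1), smallInv]
  refine congrArg _ (h.trans (congrArg card (filter_congr fun p _ => ?_)))
  omega

end Translation

theorem excPos_eq_empty {g r n : ℕ} {σ : Equiv.Perm ℕ} (hn : n ≤ r) (hσ : FixesFrom n σ) :
    excPos g r n σ = ∅ :=
  filter_eq_empty_iff.2 fun i hi hX => by
    have := (hσ.lt_iff i).2 (mem_range.1 hi)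
    have := hX.2
    omega

theorem desPos_eq_empty {r n : ℕ} {σ : Equiv.Perm ℕ} (hn : n ≤ r) (hσ : FixesFrom n σ) :
    desPos r n σ = ∅ :=
  filter_eq_empty_iff.2 fun i hi hX => by
    have := (hσ.lt_iff i).2 (mem_range.1 hi)
    omega

theorem denN_eq_rmajN {g r n : ℕ} {σ : Equiv.Perm ℕ} (hn : n ≤ r) (hσ : FixesFrom n σ) :
    denN g r n σ = rmajN r n σ := by
  have h0 := excPos_eq_empty (g := g) hn hσ
  have h1 : nexcPos g r n σ = range n := filter_true_of_mem fun i hi h =>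
    notMem_empty i (h0 ▸ mem_filter.2 ⟨hi, h⟩)
  have h2 : smallInv r σ (range n) = invN σ (range n) := by
    refine congrArg card (filter_congr fun p hp => ?_)
    have := (hσ.lt_iff p.1).2 (mem_range.1 (mem_product.1 hp).1)
    omega
  rw [denN, rmajN, h0, h1, desPos_eq_empty hn hσ, h2, sum_empty, sum_empty, invN, product_empty,
    filter_empty, card_empty, zero_add]

/-- The pairs `(excN, denN)` and `(rdes, rmaj)` have the same joint distribution. -/
theorem sum_excN_denN_eq {g L : ℕ} (hg : 1 ≤ g) (n : ℕ) (φ : ℕ → ℕ → ℕ) :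
    ∑ σ ∈ permsBelow n, φ (excN g (g + L) L n σ) (denN g (g + L) n σ) =
      ∑ σ ∈ permsBelow n, φ (desPos (g + L) n σ).card (rmajN (g + L) n σ) := by
  induction n generalizing φ with
  | zero =>
    refine sum_congr rfl fun σ hσ => ?_
    rw [mem_permsBelow] at hσ
    rw [excN, excPos_eq_empty (Nat.zero_le _) hσ, desPos_eq_empty (Nat.zero_le _) hσ,
      denN_eq_rmajN (Nat.zero_le _) hσ, filter_empty]
  | succ n ih =>
    rcases Nat.lt_or_ge n (g + L) with hn | hn
    · refine sum_congr rfl fun σ hσ => ?_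
      rw [mem_permsBelow] at hσ
      rw [excN, excPos_eq_empty hn hσ, desPos_eq_empty hn hσ, denN_eq_rmajN hn hσ, filter_empty]
    · rw [sum_permsBelow_succ (r := g + L) (d := fun σ => excN g (g + L) L n σ)
          (d' := fun σ => excN g (g + L) L (n + 1) σ) (m := fun σ => denN g (g + L) n σ)
          (m' := fun σ => denN g (g + L) (n + 1) σ)
          (F := insExc g (g + L) n) (inc := fun σ => denInc g (g + L) n σ)
          (fun σ hσ p _ => insExc_fixesFrom hσ)
          (fun σ hσ p hp τ hτ q hq h => insExc_injective hg hn hσ hp hτ hq h)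
          (fun σ hσ p hp => denN_insExc hg hn hσ hp)
          (fun σ hσ p hp => excN_insExc hg hn hσ hp)
          (fun σ hσ p hp => denInc_le hg hσ hp)
          (fun σ hσ p hp q hq h => denInc_injective hg hσ hp hq h),
        sum_permsBelow_succ (r := g + L) (d := fun σ => (desPos (g + L) n σ).card)
          (d' := fun σ => (desPos (g + L) (n + 1) σ).card) (m := fun σ => rmajN (g + L) n σ)
          (m' := fun σ => rmajN (g + L) (n + 1) σ)
          (F := insWord n) (inc := fun σ => majInc (g + L) n σ)
          (fun σ hσ p _ => insWord_fixesFrom hσ)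
          (fun σ hσ p hp τ hτ q hq h => insWord_injective hσ hp hτ hq h)
          (fun σ hσ p hp => (rmajN_insWord_and_card (by omega) hσ hp).1)
          (fun σ hσ p hp => card_desPos_insWord (by omega) hn hσ hp)
          (fun σ hσ p hp => majInc_le hp)
          (fun σ hσ p hp q hq h => majInc_injective hp hq h)]
      exact ih fun a b =>
        ∑ c ∈ range (n + 1), φ (a + if g + L + a ≤ c then 1 else 0) (b + c)

/-- Theorem 1.2(2) (Huang–Yan): the pair `(g exc_ℓ, g den_{g+ℓ})` is
`(g+ℓ−1)`-Euler–Mahonian. -/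
theorem gexc_gdenLvl_gl_is_euler_mahonian (g l n : ℕ) (hg : 1 ≤ g) (hl : 1 ≤ l)
    (hn : 1 ≤ n) (a b : ℕ) :
    ((univ : Finset (Equiv.Perm (Fin n))).filter fun σ =>
        gexc g l σ = a ∧ gden g (g + l) σ = b).card
      = ((univ : Finset (Equiv.Perm (Fin n))).filter fun σ =>
          rdes (g + l - 1) σ = a ∧ rmaj (g + l - 1) σ = b).card := by
  obtain ⟨L, rfl⟩ : ∃ L, l = L + 1 := ⟨l - 1, by omega⟩
  have h := sum_excN_denN_eq (L := L) hg n fun x y => if x = a ∧ y = b then 1 else 0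
  rw [sum_permsBelow, sum_permsBelow] at h
  simp only [← gexc_eq_excN, ← gden_eq_denN, ← rdes_eq_card, ← rmaj_eq_rmajN] at h
  rw [card_filter, card_filter]
  exact h

end PaperStmt
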